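/- arXiv:math-ph/0502030 — 10 statements merged into one kernel-verified Lean document; each statement's English description precedes it below -/
import Mathlib

section
/- For every real σ ≥ 0, the infinite matrix A(σ) indexed by m,n ∈ ℕ = {1,2,3,…} with entries A(σ)_{mn} = 0 for m = n, A(σ)_{mn} = −(i/n)(m/n)^σ for m < n, and A(σ)_{mn} = (i/m)(n/m)^σ for m > n defines a bounded linear operator on ℓ²(ℕ), and its operator norm satisfies ‖A(σ)‖ ≤ 24. -/
open Filter Topology

/-- The finite-section form of the Schur test. -/
theorem schur_finite_section {ι : Type*} (a : ι → ι → ℝ) (ha : ∀ m n, 0 ≤ a m n)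
    (w : ι → ℝ) (hw : ∀ n, 0 < w n) (C : ℝ) (hC : 0 ≤ C)
    (hrow : ∀ m (s : Finset ι), ∑ n ∈ s, a m n * w n ≤ C * w m)
    (hcol : ∀ n (s : Finset ι), ∑ m ∈ s, a m n * w m ≤ C * w n)
    (x : ι → ℝ) (s t : Finset ι) :
    ∑ m ∈ t, (∑ n ∈ s, a m n * x n) ^ 2 ≤ C ^ 2 * ∑ n ∈ s, x n ^ 2 := by
  have hcs : ∀ m, (∑ n ∈ s, a m n * x n) ^ 2
      ≤ C * w m * ∑ n ∈ s, a m n * (x n ^ 2 / w n) := by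
    intro m
    have h : (∑ n ∈ s, a m n * x n) ^ 2
        ≤ (∑ n ∈ s, a m n * w n) * ∑ n ∈ s, a m n * (x n ^ 2 / w n) := by
      refine Finset.sum_sq_le_sum_mul_sum_of_sq_le_mul s
        (fun n _ => mul_nonneg (ha m n) (hw n).le)
        (fun n _ => mul_nonneg (ha m n) (div_nonneg (sq_nonneg _) (hw n).le)) (fun n _ => le_of_eq ?_)
      have := (hw n).ne'
      field_simp
    exact h.trans (mul_le_mul_of_nonneg_right (hrow m s) (Finset.sum_nonneg fun n _ =>
      mul_nonneg (ha m n) (div_nonneg (sq_nonneg _) (hw n).le)))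
  calc ∑ m ∈ t, (∑ n ∈ s, a m n * x n) ^ 2
      ≤ ∑ m ∈ t, C * w m * ∑ n ∈ s, a m n * (x n ^ 2 / w n) :=
        Finset.sum_le_sum fun m _ => hcs m
    _ = ∑ n ∈ s, C * (x n ^ 2 / w n) * ∑ m ∈ t, a m n * w m := by
        simp_rw [Finset.mul_sum]
        rw [Finset.sum_comm]
        exact Finset.sum_congr rfl fun n _ => Finset.sum_congr rfl fun m _ => by ring
    _ ≤ ∑ n ∈ s, C * (x n ^ 2 / w n) * (C * w n) :=
        Finset.sum_le_sum fun n _ => mul_le_mul_of_nonneg_left (hcol n t)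
          (mul_nonneg hC (div_nonneg (sq_nonneg _) (hw n).le))
    _ = C ^ 2 * ∑ n ∈ s, x n ^ 2 := by
        rw [Finset.mul_sum]
        refine Finset.sum_congr rfl fun n _ => ?_
        have := (hw n).ne'
        field_simp

/-- The Schur test: a matrix whose absolute row and column sums against a positive weight `w` are
at most `C * w` defines an operator on `ℓ²` of norm at most `C`. -/
theorem exists_clm_of_schur_test {ι : Type*} [DecidableEq ι] (A : ι → ι → ℂ)
    (w : ι → ℝ) (hw : ∀ n, 0 < w n) (C : ℝ) (hC : 0 ≤ C)
    (hrow : ∀ m (s : Finset ι), ∑ n ∈ s, ‖A m n‖ * w n ≤ C * w m)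
    (hcol : ∀ n (s : Finset ι), ∑ m ∈ s, ‖A m n‖ * w m ≤ C * w n) :
    ∃ T : lp (fun _ : ι => ℂ) 2 →L[ℂ] lp (fun _ : ι => ℂ) 2, ‖T‖ ≤ C ∧
      ∀ m n, @inner ℂ _ _ (lp.single 2 m (1 : ℂ)) (T (lp.single 2 n (1 : ℂ))) = A m n := by
  have hsec : ∀ (x : lp (fun _ : ι => ℂ) 2) (s t : Finset ι),
      ∑ m ∈ t, (∑ n ∈ s, ‖A m n‖ * ‖x n‖) ^ 2 ≤ (C * ‖x‖) ^ 2 := by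
    intro x s t
    have hx : ∑ n ∈ s, ‖x n‖ ^ 2 ≤ ‖x‖ ^ 2 := by
      simpa using lp.sum_rpow_le_norm_rpow (p := 2) (by norm_num) x s
    rw [mul_pow]
    exact (schur_finite_section (fun m n => ‖A m n‖) (fun _ _ => norm_nonneg _) w hw C hC hrow
      hcol (fun n => ‖x n‖) s t).trans (mul_le_mul_of_nonneg_left hx (sq_nonneg C))
  have hsumm : ∀ (x : lp (fun _ : ι => ℂ) 2) (m : ι), Summable fun n => A m n * x n := by
    intro x m
    refine Summable.of_norm (summable_of_sum_le (c := C * ‖x‖) (fun _ => norm_nonneg _) ?_)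
    intro s
    have h := hsec x s {m}
    rw [Finset.sum_singleton] at h
    simp_rw [norm_mul]
    exact le_of_sq_le_sq h (by positivity)
  have hbound : ∀ (x : lp (fun _ : ι => ℂ) 2) (t : Finset ι),
      ∑ m ∈ t, ‖∑' n, A m n * x n‖ ^ 2 ≤ (C * ‖x‖) ^ 2 := by
    intro x t
    have hlim : Tendsto (fun s : Finset ι => ∑ m ∈ t, ‖∑ n ∈ s, A m n * x n‖ ^ 2) atTop
        (𝓝 (∑ m ∈ t, ‖∑' n, A m n * x n‖ ^ 2)) :=
      tendsto_finsetSum _ fun m _ => ((hsumm x m).hasSum.norm).pow 2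
    refine le_of_tendsto' hlim fun s => le_trans (Finset.sum_le_sum fun m _ => ?_) (hsec x s t)
    refine pow_le_pow_left₀ (norm_nonneg _) ((norm_sum_le _ _).trans_eq ?_) 2
    simp_rw [norm_mul]
  have hmem : ∀ x : lp (fun _ : ι => ℂ) 2, Memℓp (fun m => ∑' n, A m n * x n) 2 := fun x =>
    memℓp_gen' (C := (C * ‖x‖) ^ 2) fun t => by simpa using hbound x t
  let L : lp (fun _ : ι => ℂ) 2 →ₗ[ℂ] lp (fun _ : ι => ℂ) 2 :=
    { toFun := fun x => ⟨fun m => ∑' n, A m n * x n, hmem x⟩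
      map_add' := fun x y => by
        ext m
        simp only [lp.coeFn_add, Pi.add_apply, mul_add]
        exact (hsumm x m).tsum_add (hsumm y m)
      map_smul' := fun c x => by
        ext m
        simp only [lp.coeFn_smul, Pi.smul_apply, smul_eq_mul, RingHom.id_apply, ← tsum_mul_left]
        exact tsum_congr fun n => by ring }
  refine ⟨L.mkContinuous C fun x => ?_, L.mkContinuous_norm_le hC _, fun m n => ?_⟩
  · refine lp.norm_le_of_forall_sum_le (by norm_num) (by positivity) fun t => ?_
    simpa [L] using hbound x t
  · rw [lp.inner_single_left]
    change inner ℂ 1 (∑' k, A m k * (lp.single 2 n (1 : ℂ) : lp (fun _ : ι => ℂ) 2) k) = _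
    rw [tsum_eq_single n]
    · simp
    · intro k hk
      simp [lp.single_apply, hk]

theorem one_div_sqrt_succ_le (n : ℕ) : 1 / √(n + 1 : ℝ) ≤ 2 * √(n + 1 : ℝ) - 2 * √(n : ℝ) := by
  have hb : 0 < √(n + 1 : ℝ) := Real.sqrt_pos.2 (by positivity)
  have ha2 : √(n : ℝ) ^ 2 = n := Real.sq_sqrt (by positivity)
  have hb2 : √(n + 1 : ℝ) ^ 2 = n + 1 := Real.sq_sqrt (by positivity)
  rw [div_le_iff₀ hb]
  nlinarith [sq_nonneg (√(n + 1 : ℝ) - √(n : ℝ))]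

theorem one_div_mul_sqrt_succ_le (n : ℕ) (hn : 0 < n) :
    1 / ((n + 1 : ℝ) * √(n + 1 : ℝ)) ≤ 2 / √(n : ℝ) - 2 / √(n + 1 : ℝ) := by
  have ha : 0 < √(n : ℝ) := Real.sqrt_pos.2 (by positivity)
  have hb : 0 < √(n + 1 : ℝ) := Real.sqrt_pos.2 (by positivity)
  have ha2 : √(n : ℝ) ^ 2 = n := Real.sq_sqrt (by positivity)
  have hb2 : √(n + 1 : ℝ) ^ 2 = n + 1 := Real.sq_sqrt (by positivity)
  set a := √(n : ℝ)
  set b := √(n + 1 : ℝ)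
  have hab : a ≤ b := Real.sqrt_le_sqrt (by linarith)
  have h1 : (b - a) * (b + a) = 1 := by linarith [sq_sub_sq b a]
  rw [← hb2, div_sub_div _ _ ha.ne' hb.ne', div_le_div_iff₀ (by positivity) (by positivity)]
  have h2 : 1 ≤ 2 * b * (b - a) := by nlinarith
  have h3 : a * b ≤ b ^ 2 := by nlinarith
  nlinarith [mul_le_mul_of_nonneg_left h2 (by positivity : 0 ≤ b ^ 2)]

/-- Partial sums of the kernel `1 / max m n` against the weight `1 / √n`. -/
theorem sum_range_one_div_max_le (m : ℕ) (hm : 0 < m) (N : ℕ) :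
    ∑ k ∈ Finset.range N, 1 / (max m (k + 1) : ℝ) * (1 / √(k + 1 : ℝ)) ≤
      if N ≤ m then 2 * √(N : ℝ) / m else 4 / √(m : ℝ) - 2 / √(N : ℝ) := by
  have hm0 : (0 : ℝ) < m := by exact_mod_cast hm
  induction N with
  | zero => simp
  | succ N ih =>
    rw [Finset.sum_range_succ]
    rcases lt_or_ge N m with h | h
    · rw [if_pos h.le] at ih
      rw [if_pos (Nat.succ_le_of_lt h)]
      have hmax : max (m : ℝ) (N + 1) = m := max_eq_left (by exact_mod_cast h)
      have := mul_le_mul_of_nonneg_left (one_div_sqrt_succ_le N)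
        (by positivity : (0 : ℝ) ≤ 1 / m)
      rw [hmax]
      push_cast
      calc _ ≤ 2 * √(N : ℝ) / m + 1 / m * (2 * √(N + 1 : ℝ) - 2 * √(N : ℝ)) := add_le_add ih this
        _ = _ := by ring
    · rw [if_neg (by omega)]
      have hmax : max (m : ℝ) (N + 1) = N + 1 := max_eq_right (by exact_mod_cast (by omega))
      have ih' : ∑ k ∈ Finset.range N, 1 / (max m (k + 1) : ℝ) * (1 / √(k + 1 : ℝ)) ≤
          4 / √(m : ℝ) - 2 / √(N : ℝ) := by
        rcases h.eq_or_lt with rfl | h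
        · rw [if_pos le_rfl] at ih
          refine ih.trans_eq ?_
          rw [mul_div_assoc, Real.sqrt_div_self]
          ring
        · rwa [if_neg (by omega)] at ih
      have := one_div_mul_sqrt_succ_le N (by omega)
      rw [hmax, one_div_mul_one_div]
      push_cast
      linarith

theorem sum_pnat_one_div_max_le (m : ℕ+) (s : Finset ℕ+) :
    ∑ n ∈ s, 1 / (max (m : ℕ) (n : ℕ) : ℝ) * (1 / √((n : ℕ) : ℝ)) ≤ 4 * (1 / √((m : ℕ) : ℝ)) := by
  set f : ℕ → ℝ := fun k => 1 / (max (m : ℕ) (k + 1) : ℝ) * (1 / √(k + 1 : ℝ))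
  obtain ⟨N, hN⟩ := (s.image PNat.natPred).exists_nat_subset_range
  have hs : ∑ n ∈ s, 1 / (max (m : ℕ) (n : ℕ) : ℝ) * (1 / √((n : ℕ) : ℝ)) =
      ∑ k ∈ s.image PNat.natPred, f k := by
    rw [Finset.sum_image PNat.natPred_injective.injOn]
    refine Finset.sum_congr rfl fun n _ => ?_
    have : ((n.natPred : ℕ) : ℝ) + 1 = (n : ℕ) := by exact_mod_cast n.natPred_add_one
    simp only [f, this]
  rw [hs]
  refine (Finset.sum_le_sum_of_subset_of_nonneg hN fun k _ _ => by positivity).trans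
    ((sum_range_one_div_max_le m m.pos N).trans ?_)
  have hm : (0 : ℝ) < (m : ℕ) := by exact_mod_cast m.pos
  split_ifs with h
  · have h1 : √(N : ℝ) ≤ √((m : ℕ) : ℝ) := Real.sqrt_le_sqrt (by exact_mod_cast h)
    have h2 : 2 * √(N : ℝ) / (m : ℕ) ≤ 2 * (√((m : ℕ) : ℝ) / (m : ℕ)) := by
      rw [mul_div_assoc]
      gcongr
    rw [Real.sqrt_div_self] at h2
    have : 0 ≤ 1 / √((m : ℕ) : ℝ) := by positivity
    rw [one_div] at this ⊢
    linarith
  · have : 0 ≤ 2 / √(N : ℝ) := by positivity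
    have h4 : 4 / √((m : ℕ) : ℝ) = 4 * (1 / √((m : ℕ) : ℝ)) := by ring
    linarith

theorem norm_I_div_mul_rpow_le (σ : ℝ) (hσ : 0 ≤ σ) (k l : ℕ+) (h : k ≤ l) :
    ‖(Complex.I / ((l : ℕ) : ℂ)) * (((((k : ℕ) : ℝ) / ((l : ℕ) : ℝ)) ^ σ : ℝ) : ℂ)‖ ≤
      1 / ((l : ℕ) : ℝ) := by
  have hl : (0 : ℝ) < (l : ℕ) := by exact_mod_cast l.pos
  have hkl : ((k : ℕ) : ℝ) ≤ (l : ℕ) := by exact_mod_cast h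
  have h0 : (0 : ℝ) ≤ ((k : ℕ) : ℝ) / ((l : ℕ) : ℝ) := by positivity
  rw [norm_mul, norm_div, Complex.norm_I, Complex.norm_natCast, Complex.norm_real,
    Real.norm_of_nonneg (Real.rpow_nonneg h0 σ)]
  exact mul_le_of_le_one_right (by positivity)
    (Real.rpow_le_one h0 ((div_le_one hl).2 hkl) hσ)


/-- For every real `σ ≥ 0`, the infinite matrix `A(σ)` indexed by positive
integers with entries `0` on the diagonal, `-(i/n)(m/n)^σ` for `m < n` and `(i/m)(n/m)^σ`
for `m > n` defines a bounded linear operator on `ℓ²(ℕ)` of operator norm at most `24`. -/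
theorem stmt_0 (σ : ℝ) (hσ : 0 ≤ σ) :
    ∃ T : lp (fun _ : ℕ+ => ℂ) 2 →L[ℂ] lp (fun _ : ℕ+ => ℂ) 2,
      ‖T‖ ≤ 24 ∧
      ∀ m n : ℕ+,
        @inner ℂ _ _ (lp.single 2 m (1 : ℂ)) (T (lp.single 2 n (1 : ℂ))) =
          if m = n then 0
          else if m < n then
            -(Complex.I / ((n : ℕ) : ℂ)) * (((((m : ℕ) : ℝ) / ((n : ℕ) : ℝ)) ^ σ : ℝ) : ℂ)
          else (Complex.I / ((m : ℕ) : ℂ)) * (((((n : ℕ) : ℝ) / ((m : ℕ) : ℝ)) ^ σ : ℝ) : ℂ) := by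
  set A : ℕ+ → ℕ+ → ℂ := fun m n =>
    if m = n then 0
    else if m < n then
      -(Complex.I / ((n : ℕ) : ℂ)) * (((((m : ℕ) : ℝ) / ((n : ℕ) : ℝ)) ^ σ : ℝ) : ℂ)
    else (Complex.I / ((m : ℕ) : ℂ)) * (((((n : ℕ) : ℝ) / ((m : ℕ) : ℝ)) ^ σ : ℝ) : ℂ) with hA
  have hbd : ∀ m n, ‖A m n‖ ≤ 1 / (max (m : ℕ) (n : ℕ) : ℝ) := by
    intro m n
    simp only [hA]
    split_ifs with h1 h2
    · rw [norm_zero]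
      positivity
    · rw [max_eq_right (by exact_mod_cast h2.le), neg_mul, norm_neg]
      exact norm_I_div_mul_rpow_le σ hσ m n h2.le
    · rw [max_eq_left (by exact_mod_cast not_lt.1 h2)]
      exact norm_I_div_mul_rpow_le σ hσ n m (not_lt.1 h2)
  obtain ⟨T, hT, hTA⟩ := exists_clm_of_schur_test A (fun n => 1 / √((n : ℕ) : ℝ))
    (fun n => one_div_pos.2 (Real.sqrt_pos.2 (by exact_mod_cast n.pos))) 4 (by norm_num)
    (fun m s => (Finset.sum_le_sum fun n _ =>
      mul_le_mul_of_nonneg_right (hbd m n) (by positivity)).trans (sum_pnat_one_div_max_le m s))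
    (fun n s => (Finset.sum_le_sum fun m _ =>
      mul_le_mul_of_nonneg_right ((hbd m n).trans_eq (by rw [max_comm])) (by positivity)).trans
        (sum_pnat_one_div_max_le n s))
  exact ⟨T, hT.trans (by norm_num), hTA⟩
end

section
/- For every real σ ≥ 0, the integral operator K(σ) on L²((0,∞), dx) whose integral kernel is K_σ(x,y) = −(i/y)(x/y)^σ for x < y and K_σ(x,y) = (i/x)(y/x)^σ for x > y is bounded, and its operator norm equals 2/(2σ+1). -/
open MeasureTheory

open scoped ENNReal NNReal InnerProductSpace

section KernelOperators

variable {α : Type*} [MeasurableSpace α] {μ : Measure α}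

/-- A measurable real kernel whose absolute value is bounded on `L²(μ)`. -/
def IsL2Kernel (μ : Measure α) (k : α → α → ℝ) : Prop :=
  Measurable (Function.uncurry k) ∧ ∃ C : ℝ≥0, ∀ g : α → ℝ≥0∞, Measurable g →
    ∫⁻ x, (∫⁻ y, ‖k x y‖ₑ * g y ∂μ) ^ 2 ∂μ ≤ (C : ℝ≥0∞) ^ 2 * ∫⁻ y, g y ^ 2 ∂μ

/-- The Schur test. -/
lemma isL2Kernel_of_schur [SFinite μ] {k : α → α → ℝ} (hk : Measurable (Function.uncurry k))
    {w : α → ℝ≥0∞} (hw : Measurable w) (hw0 : ∀ᵐ x ∂μ, w x ≠ 0 ∧ w x ≠ ∞) (C : ℝ≥0)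
    (h₁ : ∀ᵐ x ∂μ, ∫⁻ y, ‖k x y‖ₑ * w y ∂μ ≤ C * w x)
    (h₂ : ∀ᵐ y ∂μ, ∫⁻ x, ‖k x y‖ₑ * w x ∂μ ≤ C * w y) : IsL2Kernel μ k := by
  have hke : Measurable fun p : α × α => ‖k p.1 p.2‖ₑ := hk.enorm
  have hk₁ (x : α) : Measurable fun y => ‖k x y‖ₑ := hke.comp measurable_prodMk_left
  have hk₂ (y : α) : Measurable fun x => ‖k x y‖ₑ := hke.comp measurable_prodMk_right
  refine ⟨hk, C, fun g hg => ?_⟩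
  have pointwise : ∀ᵐ x ∂μ, (∫⁻ y, ‖k x y‖ₑ * g y ∂μ) ^ 2 ≤
      C * ∫⁻ y, w x * (‖k x y‖ₑ * (g y ^ 2 * (w y)⁻¹)) ∂μ := by
    filter_upwards [h₁] with x hx
    have cs := ENNReal.lintegral_mul_norm_pow_le (μ := μ)
      (f := fun y => ‖k x y‖ₑ * w y) (g := fun y => ‖k x y‖ₑ * (g y ^ 2 * (w y)⁻¹))
      ((hk₁ x).mul hw).aemeasurable ((hk₁ x).mul ((hg.pow_const 2).mul hw.inv)).aemeasurable
      (p := 1 / 2) (q := 1 / 2) (by norm_num) (by norm_num) (by norm_num)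
    have e : ∫⁻ y, (‖k x y‖ₑ * w y) ^ (1 / 2 : ℝ) *
        (‖k x y‖ₑ * (g y ^ 2 * (w y)⁻¹)) ^ (1 / 2 : ℝ) ∂μ = ∫⁻ y, ‖k x y‖ₑ * g y ∂μ := by
      refine lintegral_congr_ae ?_
      filter_upwards [hw0] with y hy
      rw [← ENNReal.mul_rpow_of_nonneg _ _ (by norm_num)]
      have : ‖k x y‖ₑ * w y * (‖k x y‖ₑ * (g y ^ 2 * (w y)⁻¹)) = (‖k x y‖ₑ * g y) ^ (2 : ℝ) := by
        rw [ENNReal.rpow_two]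
        calc _ = (‖k x y‖ₑ * g y) ^ 2 * (w y * (w y)⁻¹) := by ring
          _ = _ := by rw [ENNReal.mul_inv_cancel hy.1 hy.2, mul_one]
      rw [this, ← ENNReal.rpow_mul]
      norm_num
    rw [e, ← ENNReal.mul_rpow_of_nonneg _ _ (by norm_num)] at cs
    calc _ ≤ ((((∫⁻ y, ‖k x y‖ₑ * w y ∂μ) *
          ∫⁻ y, ‖k x y‖ₑ * (g y ^ 2 * (w y)⁻¹) ∂μ)) ^ (1 / 2 : ℝ)) ^ 2 := by gcongr
      _ = (∫⁻ y, ‖k x y‖ₑ * w y ∂μ) * ∫⁻ y, ‖k x y‖ₑ * (g y ^ 2 * (w y)⁻¹) ∂μ := by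
        rw [← ENNReal.rpow_two, ← ENNReal.rpow_mul]
        norm_num
      _ ≤ (C * w x) * ∫⁻ y, ‖k x y‖ₑ * (g y ^ 2 * (w y)⁻¹) ∂μ := by gcongr
      _ = _ := by
        rw [mul_assoc]
        congr 1
        exact (lintegral_const_mul (w x)
          ((hk₁ x).mul ((hg.pow_const 2).mul hw.inv))).symm
  have hm : Measurable (Function.uncurry fun x y =>
      w x * (‖k x y‖ₑ * (g y ^ 2 * (w y)⁻¹))) :=
    (hw.comp measurable_fst).mul
      (hke.mul (((hg.pow_const 2).mul hw.inv).comp measurable_snd))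
  calc _ ≤ ∫⁻ x, C * ∫⁻ y, w x * (‖k x y‖ₑ * (g y ^ 2 * (w y)⁻¹)) ∂μ ∂μ :=
        lintegral_mono_ae pointwise
    _ = C * ∫⁻ y, (∫⁻ x, w x * (‖k x y‖ₑ * (g y ^ 2 * (w y)⁻¹)) ∂μ) ∂μ := by
        rw [lintegral_const_mul _ hm.lintegral_prod_right, lintegral_lintegral_swap hm.aemeasurable]
    _ ≤ C * ∫⁻ y, C * g y ^ 2 ∂μ := by
        refine mul_le_mul_right (lintegral_mono_ae ?_) _
        filter_upwards [h₂, hw0] with y hy hy0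
        calc _ = ∫⁻ x, (‖k x y‖ₑ * w x) * (g y ^ 2 * (w y)⁻¹) ∂μ := by
              congr with x; ring
          _ = (∫⁻ x, ‖k x y‖ₑ * w x ∂μ) * (g y ^ 2 * (w y)⁻¹) :=
              lintegral_mul_const _ ((hk₂ y).mul hw)
          _ ≤ (C * w y) * (g y ^ 2 * (w y)⁻¹) := by gcongr
          _ = C * g y ^ 2 * (w y * (w y)⁻¹) := by ring
          _ = _ := by rw [ENNReal.mul_inv_cancel hy0.1 hy0.2, mul_one]
    _ = _ := by rw [lintegral_const_mul _ (hg.pow_const 2)]; ring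

lemma enorm_ofReal (r : ℝ) : ‖(r : ℂ)‖ₑ = ‖r‖ₑ := by
  rw [enorm_eq_iff_norm_eq, Complex.norm_real]

lemma eLpNorm_two_sq {E : Type*} [NormedAddCommGroup E] (f : α → E) :
    eLpNorm f 2 μ ^ 2 = ∫⁻ x, ‖f x‖ₑ ^ 2 ∂μ := by
  have := eLpNorm_nnreal_pow_eq_lintegral (μ := μ) (f := f) (p := 2) (by norm_num)
  simpa using this

lemma lintegral_enorm_sq_lt_top (f : Lp ℂ 2 μ) : ∫⁻ x, ‖f x‖ₑ ^ 2 ∂μ < ∞ := by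
  rw [← eLpNorm_two_sq]
  exact ENNReal.pow_lt_top (Lp.memLp f).2

namespace IsL2Kernel

variable {k : α → α → ℝ}

lemma measurable_enorm (hk : IsL2Kernel μ k) : Measurable fun p : α × α => ‖k p.1 p.2‖ₑ :=
  hk.1.enorm

lemma lintegral_sq_lt_top (hk : IsL2Kernel μ k) {g : α → ℝ≥0∞} (hg : Measurable g)
    (h : ∫⁻ x, g x ^ 2 ∂μ < ∞) : ∫⁻ x, (∫⁻ y, ‖k x y‖ₑ * g y ∂μ) ^ 2 ∂μ < ∞ := by
  obtain ⟨C, hC⟩ := hk.2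
  exact (hC g hg).trans_lt (ENNReal.mul_lt_top (by finiteness) h)

lemma measurable_enorm_coe (f : Lp ℂ 2 μ) : Measurable fun x => ‖f x‖ₑ :=
  (Lp.stronglyMeasurable f).measurable.enorm

lemma stronglyMeasurable_mul (hk : IsL2Kernel μ k) (f : Lp ℂ 2 μ) :
    StronglyMeasurable (Function.uncurry fun x y => (k x y : ℂ) * f y) :=
  ((Complex.measurable_ofReal.comp hk.1).mul
    ((Lp.stronglyMeasurable f).measurable.comp measurable_snd)).stronglyMeasurable

lemma enorm_integral_le (f : Lp ℂ 2 μ) (x : α) :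
    ‖∫ y, (k x y : ℂ) * f y ∂μ‖ₑ ≤ ∫⁻ y, ‖k x y‖ₑ * ‖f y‖ₑ ∂μ :=
  (enorm_integral_le_lintegral_enorm _).trans_eq (by simp [enorm_mul, enorm_ofReal])

variable [SFinite μ]

lemma measurable_lintegral (hk : IsL2Kernel μ k) {g : α → ℝ≥0∞} (hg : Measurable g) :
    Measurable fun x => ∫⁻ y, ‖k x y‖ₑ * g y ∂μ :=
  Measurable.lintegral_prod_right (f := fun x y => ‖k x y‖ₑ * g y)
    (hk.measurable_enorm.mul (hg.comp measurable_snd))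

lemma ae_lintegral_lt_top (hk : IsL2Kernel μ k) {g : α → ℝ≥0∞} (hg : Measurable g)
    (h : ∫⁻ x, g x ^ 2 ∂μ < ∞) : ∀ᵐ x ∂μ, ∫⁻ y, ‖k x y‖ₑ * g y ∂μ < ∞ := by
  filter_upwards [ae_lt_top ((hk.measurable_lintegral hg).pow_const 2)
    (hk.lintegral_sq_lt_top hg h).ne] with x hx
  simpa using hx

lemma ae_integrable (hk : IsL2Kernel μ k) (f : Lp ℂ 2 μ) :
    ∀ᵐ x ∂μ, Integrable (fun y => (k x y : ℂ) * f y) μ := by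
  filter_upwards [hk.ae_lintegral_lt_top (measurable_enorm_coe f) (lintegral_enorm_sq_lt_top f)]
    with x hx
  refine ⟨((hk.stronglyMeasurable_mul f).comp_measurable
    measurable_prodMk_left).aestronglyMeasurable, ?_⟩
  simpa [HasFiniteIntegral, enorm_mul, enorm_ofReal] using hx

lemma memLp_integral (hk : IsL2Kernel μ k) (f : Lp ℂ 2 μ) :
    MemLp (fun x => ∫ y, (k x y : ℂ) * f y ∂μ) 2 μ := by
  refine ⟨(hk.stronglyMeasurable_mul f).integral_prod_right.aestronglyMeasurable, ?_⟩
  have : eLpNorm (fun x => ∫ y, (k x y : ℂ) * f y ∂μ) 2 μ ^ 2 < ∞ := by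
    rw [eLpNorm_two_sq]
    refine lt_of_le_of_lt (lintegral_mono fun x => ?_)
      (hk.lintegral_sq_lt_top (measurable_enorm_coe f) (lintegral_enorm_sq_lt_top f))
    gcongr
    exact enorm_integral_le f x
  simpa using this

/-- The integral operator on `L²(μ)` with kernel `k`. -/
theorem exists_clm (hk : IsL2Kernel μ k) : ∃ T : Lp ℂ 2 μ →L[ℂ] Lp ℂ 2 μ,
    ∀ f : Lp ℂ 2 μ, ∀ᵐ x ∂μ, T f x = ∫ y, (k x y : ℂ) * f y ∂μ := by
  obtain ⟨C, hC⟩ := hk.2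
  let T₀ : Lp ℂ 2 μ →ₗ[ℂ] Lp ℂ 2 μ :=
    { toFun := fun f => (hk.memLp_integral f).toLp
      map_add' := fun f g => by
        ext1
        filter_upwards [(hk.memLp_integral (f + g)).coeFn_toLp, (hk.memLp_integral f).coeFn_toLp,
          (hk.memLp_integral g).coeFn_toLp, Lp.coeFn_add (hk.memLp_integral f).toLp
          (hk.memLp_integral g).toLp, hk.ae_integrable f, hk.ae_integrable g]
          with x h₁ h₂ h₃ h₄ h₅ h₆
        rw [h₁, h₄, Pi.add_apply, h₂, h₃, ← integral_add h₅ h₆]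
        refine integral_congr_ae ?_
        filter_upwards [Lp.coeFn_add f g] with y hy
        rw [hy, Pi.add_apply, mul_add]
      map_smul' := fun c f => by
        ext1
        filter_upwards [(hk.memLp_integral (c • f)).coeFn_toLp, (hk.memLp_integral f).coeFn_toLp,
          Lp.coeFn_smul c (hk.memLp_integral f).toLp] with x h₁ h₂ h₃
        rw [h₁, RingHom.id_apply, h₃, Pi.smul_apply, h₂, ← integral_smul]
        refine integral_congr_ae ?_
        filter_upwards [Lp.coeFn_smul c f] with y hy
        rw [hy, Pi.smul_apply, smul_eq_mul, smul_eq_mul]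
        ring }
  refine ⟨T₀.mkContinuous C fun f => ?_, fun f => (hk.memLp_integral f).coeFn_toLp⟩
  have hle : eLpNorm (fun x => ∫ y, (k x y : ℂ) * f y ∂μ) 2 μ ≤ C * eLpNorm f 2 μ := by
    rw [← ENNReal.pow_le_pow_left_iff two_ne_zero, mul_pow, eLpNorm_two_sq, eLpNorm_two_sq]
    refine le_trans (lintegral_mono fun x => ?_) (hC _ (measurable_enorm_coe f))
    gcongr
    exact enorm_integral_le f x
  change ‖(hk.memLp_integral f).toLp‖ ≤ C * ‖f‖
  rw [Lp.norm_toLp, Lp.norm_def]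
  refine (ENNReal.toReal_mono (ENNReal.mul_ne_top (by simp) (Lp.memLp f).2.ne) hle).trans_eq ?_
  simp

/-- The adjoint of an integral operator has the transposed kernel. -/
lemma inner_left_eq (hk : IsL2Kernel μ k) {T T' : Lp ℂ 2 μ →L[ℂ] Lp ℂ 2 μ}
    (hT : ∀ f : Lp ℂ 2 μ, ∀ᵐ x ∂μ, T f x = ∫ y, (k x y : ℂ) * f y ∂μ)
    (hT' : ∀ f : Lp ℂ 2 μ, ∀ᵐ x ∂μ, T' f x = ∫ y, (k y x : ℂ) * f y ∂μ) (f g : Lp ℂ 2 μ) :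
    ⟪T' f, g⟫_ℂ = ⟪f, T g⟫_ℂ := by
  let F : α → α → ℂ := fun x y => (k x y : ℂ) * g y * starRingEnd ℂ (f x)
  have hFm : StronglyMeasurable (Function.uncurry F) :=
    (hk.stronglyMeasurable_mul g).mul (((RCLike.continuous_conj (K := ℂ)).comp_stronglyMeasurable
      (Lp.stronglyMeasurable f)).comp_measurable measurable_fst)
  have hF : Integrable (Function.uncurry F) (μ.prod μ) := by
    refine ⟨hFm.aestronglyMeasurable, ?_⟩
    have hm : Measurable fun p : α × α => ‖Function.uncurry F p‖ₑ := hFm.enorm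
    rw [HasFiniteIntegral, lintegral_prod _ hm.aemeasurable]
    have hG := hk.measurable_lintegral (measurable_enorm_coe g)
    have e : ∀ x, ∫⁻ y, ‖Function.uncurry F (x, y)‖ₑ ∂μ =
        ((fun x => ∫⁻ y, ‖k x y‖ₑ * ‖g y‖ₑ ∂μ) * fun x => ‖f x‖ₑ) x := fun x => by
      have : Measurable fun y => ‖k x y‖ₑ * ‖g y‖ₑ :=
        (hk.measurable_enorm.comp measurable_prodMk_left).mul (measurable_enorm_coe g)
      simp only [Pi.mul_apply]
      rw [← lintegral_mul_const _ this]
      simp [F, enorm_mul, enorm_ofReal]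
    simp_rw [e]
    refine (ENNReal.lintegral_mul_le_Lp_mul_Lq μ Real.HolderConjugate.two_two hG.aemeasurable
      (measurable_enorm_coe f).aemeasurable).trans_lt ?_
    simp only [ENNReal.rpow_two]
    refine ENNReal.mul_lt_top (ENNReal.rpow_lt_top_of_nonneg (by norm_num) ?_)
      (ENNReal.rpow_lt_top_of_nonneg (by norm_num) (lintegral_enorm_sq_lt_top f).ne)
    exact (hk.lintegral_sq_lt_top (measurable_enorm_coe g) (lintegral_enorm_sq_lt_top g)).ne
  rw [L2.inner_def, L2.inner_def]
  calc _ = ∫ y, ∫ x, F x y ∂μ ∂μ := by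
        refine integral_congr_ae ?_
        filter_upwards [hT' f] with y hy
        rw [hy, RCLike.inner_apply, ← integral_conj, ← integral_const_mul]
        congr with x
        simp [F]
        ring
    _ = ∫ x, ∫ y, F x y ∂μ ∂μ := (integral_integral_swap hF).symm
    _ = _ := by
        refine integral_congr_ae ?_
        filter_upwards [hT g] with x hx
        rw [hx, RCLike.inner_apply, ← integral_mul_const]

/-- The composition of two integral operators has the composed kernel. -/
lemma comp_ae_eq {k' : α → α → ℝ} (hk : IsL2Kernel μ k) (hk' : IsL2Kernel μ k')
    {T T' : Lp ℂ 2 μ →L[ℂ] Lp ℂ 2 μ}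
    (hT : ∀ f : Lp ℂ 2 μ, ∀ᵐ x ∂μ, T f x = ∫ y, (k x y : ℂ) * f y ∂μ)
    (hT' : ∀ f : Lp ℂ 2 μ, ∀ᵐ x ∂μ, T' f x = ∫ y, (k' x y : ℂ) * f y ∂μ) (f : Lp ℂ 2 μ) :
    ∀ᵐ x ∂μ, T (T' f) x = ∫ z, ((∫ y, k x y * k' y z ∂μ : ℝ) : ℂ) * f z ∂μ := by
  have hG := hk'.measurable_lintegral (measurable_enorm_coe f)
  filter_upwards [hT (T' f), hk.ae_lintegral_lt_top hG (hk'.lintegral_sq_lt_top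
    (measurable_enorm_coe f) (lintegral_enorm_sq_lt_top f))] with x hx hfin
  let F : α → α → ℂ := fun y z => (k x y : ℂ) * ((k' y z : ℂ) * f z)
  have hFm : StronglyMeasurable (Function.uncurry F) :=
    ((Complex.measurable_ofReal.comp (hk.1.comp measurable_prodMk_left)).comp
      measurable_fst).stronglyMeasurable.mul (hk'.stronglyMeasurable_mul f)
  have hF : Integrable (Function.uncurry F) (μ.prod μ) := by
    refine ⟨hFm.aestronglyMeasurable, ?_⟩
    have hm : Measurable fun p : α × α => ‖Function.uncurry F p‖ₑ := hFm.enorm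
    rw [HasFiniteIntegral, lintegral_prod _ hm.aemeasurable]
    refine lt_of_eq_of_lt ?_ hfin
    congr with y
    have : Measurable fun z => ‖k' y z‖ₑ * ‖f z‖ₑ :=
      (hk'.measurable_enorm.comp measurable_prodMk_left).mul (measurable_enorm_coe f)
    rw [← lintegral_const_mul _ this]
    simp [F, enorm_mul, enorm_ofReal]
  calc T (T' f) x = ∫ y, ∫ z, F y z ∂μ ∂μ := by
        rw [hx]
        refine integral_congr_ae ?_
        filter_upwards [hT' f] with y hy
        rw [hy, integral_const_mul]
    _ = ∫ z, ∫ y, F y z ∂μ ∂μ := integral_integral_swap hF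
    _ = _ := by
        congr with z
        rw [← integral_complex_ofReal, ← integral_mul_const]
        congr with y
        simp [F]
        ring

end IsL2Kernel

end KernelOperators

lemma norm_sub_star_le {A : Type*} [NormedRing A] [NormedAlgebra ℂ A] [StarRing A] [CStarRing A]
    [StarModule ℂ A] {c : ℝ} (hc : 0 < c) {H : A}
    (h : (c : ℂ) • (star H * H) = H + star H) : ‖H - star H‖ ≤ 2 / c := by
  have hone : ‖(1 : A)‖ ≤ 1 := by
    rcases subsingleton_or_nontrivial A with hA | hA
    · simp [Subsingleton.elim (1 : A) 0]
    · exact CStarRing.norm_one.le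
  set U : A := (c : ℂ) • H - 1 with hU
  have hUs : star U = (c : ℂ) • star H - 1 := by simp [hU, star_smul]
  have hUU : star U * U = 1 := by
    have : star U * U = (c : ℂ) • ((c : ℂ) • (star H * H) - (H + star H)) + 1 := by
      rw [hUs, hU]
      simp only [sub_mul, mul_sub, smul_mul_assoc, mul_smul_comm, one_mul, mul_one, smul_sub,
        smul_add]
      abel
    rw [this, h, sub_self, smul_zero, zero_add]
  have hUn : ‖U‖ ≤ 1 := by
    have := CStarRing.norm_star_mul_self (x := U)
    rw [hUU] at this
    nlinarith [norm_nonneg U]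
  have hUd : (c : ℂ) • (H - star H) = U - star U := by
    rw [hUs, hU, smul_sub]
    abel
  rw [le_div_iff₀ hc, mul_comm]
  calc c * ‖H - star H‖ = ‖(c : ℂ) • (H - star H)‖ := by
        rw [norm_smul, Complex.norm_real, Real.norm_of_nonneg hc.le]
    _ ≤ ‖U‖ + ‖star U‖ := hUd ▸ norm_sub_le _ _
    _ ≤ 2 := by rw [norm_star]; linarith

/-- If `H` acts on the support of a nonzero vector `f` as the scalar `l`, then
the norm of `H - H†` is at least `2 |Im l|`. -/
lemma two_mul_im_le_norm_sub {E : Type*} [NormedAddCommGroup E] [InnerProductSpace ℂ E]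
    {H H' : E →L[ℂ] E} (hadj : ∀ f g : E, ⟪H' f, g⟫_ℂ = ⟪f, H g⟫_ℂ) {f : E} (hf : f ≠ 0) {l : ℂ}
    (h : ⟪f, H f⟫_ℂ = l * ⟪f, f⟫_ℂ) : 2 * |l.im| ≤ ‖H - H'‖ := by
  have e : ⟪f, (H - H') f⟫_ℂ = ((2 * l.im : ℝ) : ℂ) * Complex.I * ⟪f, f⟫_ℂ := by
    rw [sub_apply, inner_sub_right, h, ← inner_conj_symm f (H' f), hadj, h,
      map_mul, inner_conj_symm, ← sub_mul, Complex.sub_conj]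
  have hle : ‖⟪f, (H - H') f⟫_ℂ‖ ≤ ‖H - H'‖ * (‖f‖ * ‖f‖) :=
    (norm_inner_le_norm f _).trans (by nlinarith [(H - H').le_opNorm f, norm_nonneg f])
  rw [e, norm_mul, norm_mul, Complex.norm_I, Complex.norm_real, inner_self_eq_norm_sq_to_K,
    Real.norm_eq_abs, abs_mul, abs_two] at hle
  have hpos : 0 < ‖f‖ * ‖f‖ := by positivity
  refine le_of_mul_le_mul_right (le_trans (le_of_eq ?_) hle) hpos
  simp [pow_two]

/-- The kernel `(1/x) (y/x)^σ` on `y < x`, and zero elsewhere. -/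
noncomputable def hardyKernel (σ x y : ℝ) : ℝ := if y < x then x⁻¹ * (y / x) ^ σ else 0

lemma measurable_hardyKernel (σ : ℝ) : Measurable (Function.uncurry (hardyKernel σ)) := by
  unfold hardyKernel Function.uncurry
  exact Measurable.ite (measurableSet_lt measurable_snd measurable_fst) (by fun_prop) (by fun_prop)

lemma hardyKernel_nonneg (σ : ℝ) {x y : ℝ} (hx : 0 < x) (hy : 0 < y) :
    0 ≤ hardyKernel σ x y := by
  unfold hardyKernel; positivity

lemma hardyKernel_eq (σ : ℝ) {x y : ℝ} (hx : 0 < x) (hy : 0 < y) :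
    hardyKernel σ x y = if y < x then x ^ (-1 - σ) * y ^ σ else 0 := by
  unfold hardyKernel
  congr 1
  rw [Real.div_rpow hy.le hx.le, Real.rpow_sub hx, Real.rpow_neg_one]
  ring

lemma lintegral_hardyKernel_right {σ : ℝ} (hσ : 0 ≤ σ) {x : ℝ} (hx : 0 < x) :
    ∫⁻ y in Set.Ioi (0 : ℝ), ‖hardyKernel σ x y‖ₑ * ENNReal.ofReal (y ^ (-1 / 2 : ℝ)) =
      ENNReal.ofReal (σ + 1 / 2)⁻¹ * ENNReal.ofReal (x ^ (-1 / 2 : ℝ)) := by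
  have hint : IntegrableOn (fun y : ℝ => x ^ (-1 - σ) * y ^ (σ - 1 / 2)) (Set.Ioc 0 x) := by
    have := intervalIntegral.intervalIntegrable_rpow' (a := 0) (b := x) (r := σ - 1 / 2)
      (by linarith)
    exact ((intervalIntegrable_iff_integrableOn_Ioc_of_le hx.le).1 this).const_mul _
  calc _ = ∫⁻ y in Set.Ioi (0 : ℝ), (Set.Iio x).indicator
          (fun y => ENNReal.ofReal (x ^ (-1 - σ) * y ^ (σ - 1 / 2))) y := by
        refine setLIntegral_congr_fun measurableSet_Ioi fun y hy => ?_
        have hy : 0 < y := hy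
        simp only [Set.indicator_apply, Set.mem_Iio]
        rw [Real.enorm_of_nonneg (hardyKernel_nonneg σ hx hy), hardyKernel_eq σ hx hy]
        split_ifs
        · rw [← ENNReal.ofReal_mul (by positivity), mul_assoc, ← Real.rpow_add hy]
          ring_nf
        · simp
    _ = ∫⁻ y in Set.Ioc 0 x, ENNReal.ofReal (x ^ (-1 - σ) * y ^ (σ - 1 / 2)) := by
        rw [lintegral_indicator measurableSet_Iio, Measure.restrict_restrict measurableSet_Iio,
          Set.inter_comm, Set.Ioi_inter_Iio, restrict_Ioo_eq_restrict_Ioc]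
    _ = ENNReal.ofReal (∫ y in Set.Ioc 0 x, x ^ (-1 - σ) * y ^ (σ - 1 / 2)) := by
        rw [ofReal_integral_eq_lintegral_ofReal hint]
        filter_upwards [ae_restrict_mem measurableSet_Ioc] with y hy
        have := hy.1
        simp only [Pi.zero_apply]
        positivity
    _ = _ := by
        rw [← ENNReal.ofReal_mul (by positivity), integral_const_mul,
          ← intervalIntegral.integral_of_le hx.le, integral_rpow (Or.inl (by linarith)),
          Real.zero_rpow (by linarith), sub_zero, mul_div_assoc', ← Real.rpow_add hx]
        ring_nf

lemma lintegral_hardyKernel_left {σ : ℝ} (hσ : 0 ≤ σ) {y : ℝ} (hy : 0 < y) :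
    ∫⁻ x in Set.Ioi (0 : ℝ), ‖hardyKernel σ x y‖ₑ * ENNReal.ofReal (x ^ (-1 / 2 : ℝ)) =
      ENNReal.ofReal (σ + 1 / 2)⁻¹ * ENNReal.ofReal (y ^ (-1 / 2 : ℝ)) := by
  have hint : IntegrableOn (fun x : ℝ => y ^ σ * x ^ (-3 / 2 - σ)) (Set.Ioi y) :=
    (integrableOn_Ioi_rpow_of_lt (by linarith) hy).const_mul _
  calc _ = ∫⁻ x in Set.Ioi (0 : ℝ), (Set.Ioi y).indicator
          (fun x => ENNReal.ofReal (y ^ σ * x ^ (-3 / 2 - σ))) x := by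
        refine setLIntegral_congr_fun measurableSet_Ioi fun x hx => ?_
        have hx : 0 < x := hx
        simp only [Set.indicator_apply, Set.mem_Ioi]
        rw [Real.enorm_of_nonneg (hardyKernel_nonneg σ hx hy), hardyKernel_eq σ hx hy]
        split_ifs
        · rw [← ENNReal.ofReal_mul (by positivity), mul_comm (x ^ _), mul_assoc,
            ← Real.rpow_add hx]
          ring_nf
        · simp
    _ = ∫⁻ x in Set.Ioi y, ENNReal.ofReal (y ^ σ * x ^ (-3 / 2 - σ)) := by
        rw [lintegral_indicator measurableSet_Ioi, Measure.restrict_restrict measurableSet_Ioi,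
          Set.inter_eq_left.2 (Set.Ioi_subset_Ioi hy.le)]
    _ = ENNReal.ofReal (∫ x in Set.Ioi y, y ^ σ * x ^ (-3 / 2 - σ)) := by
        rw [ofReal_integral_eq_lintegral_ofReal hint]
        filter_upwards [ae_restrict_mem measurableSet_Ioi] with x hx
        have : 0 < x := hy.trans hx
        simp only [Pi.zero_apply]
        positivity
    _ = _ := by
        rw [← ENNReal.ofReal_mul (by positivity), integral_const_mul,
          integral_Ioi_rpow_of_lt (by linarith) hy, mul_div_assoc', mul_neg, ← Real.rpow_add hy,
          show -3 / 2 - σ + 1 = -(σ + 1 / 2) by ring, neg_div_neg_eq]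
        ring_nf

lemma isL2Kernel_hardyKernel {σ : ℝ} (hσ : 0 ≤ σ) :
    IsL2Kernel (volume.restrict (Set.Ioi (0 : ℝ))) (hardyKernel σ) ∧
      IsL2Kernel (volume.restrict (Set.Ioi (0 : ℝ))) fun x y => hardyKernel σ y x := by
  have hw : Measurable fun x : ℝ => ENNReal.ofReal (x ^ (-1 / 2 : ℝ)) := by fun_prop
  have hw0 : ∀ᵐ x ∂volume.restrict (Set.Ioi (0 : ℝ)),
      ENNReal.ofReal (x ^ (-1 / 2 : ℝ)) ≠ 0 ∧ ENNReal.ofReal (x ^ (-1 / 2 : ℝ)) ≠ ∞ := by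
    filter_upwards [ae_restrict_mem measurableSet_Ioi] with x (hx : 0 < x)
    refine ⟨?_, ENNReal.ofReal_ne_top⟩
    rw [← pos_iff_ne_zero, ENNReal.ofReal_pos]
    positivity
  have h₁ := (ae_restrict_mem (μ := volume) measurableSet_Ioi).mono
    fun (x : ℝ) (hx : 0 < x) => (lintegral_hardyKernel_right hσ hx).le
  have h₂ := (ae_restrict_mem (μ := volume) measurableSet_Ioi).mono
    fun (x : ℝ) (hx : 0 < x) => (lintegral_hardyKernel_left hσ hx).le
  exact ⟨isL2Kernel_of_schur (measurable_hardyKernel σ) hw hw0 _ h₁ h₂,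
    isL2Kernel_of_schur ((measurable_hardyKernel σ).comp measurable_swap) hw hw0 _ h₂ h₁⟩

lemma integral_hardyKernel_mul_of_lt {σ : ℝ} (hσ : 0 ≤ σ) {y z : ℝ} (hy : 0 < y) (hyz : y < z) :
    ∫ x in Set.Ioi (0 : ℝ), hardyKernel σ x y * hardyKernel σ x z =
      (2 * σ + 1)⁻¹ * hardyKernel σ z y := by
  have hz := hy.trans hyz
  calc _ = ∫ x in Set.Ioi (0 : ℝ), (Set.Ioi z).indicator
          (fun x => y ^ σ * z ^ σ * x ^ (-2 - 2 * σ)) x := by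
        refine setIntegral_congr_fun measurableSet_Ioi fun x hx => ?_
        have hx : 0 < x := hx
        simp only [Set.indicator_apply, Set.mem_Ioi]
        rw [hardyKernel_eq σ hx hy, hardyKernel_eq σ hx hz]
        by_cases h : z < x
        · rw [if_pos h, if_pos (hyz.trans h), if_pos h,
            show -2 - 2 * σ = (-1 - σ) + (-1 - σ) by ring, Real.rpow_add hx]
          ring
        · simp [h]
    _ = y ^ σ * z ^ σ * (z ^ (-1 - 2 * σ) / (2 * σ + 1)) := by
        rw [integral_indicator measurableSet_Ioi, Measure.restrict_restrict measurableSet_Ioi,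
          Set.inter_eq_left.2 (Set.Ioi_subset_Ioi hz.le), integral_const_mul,
          integral_Ioi_rpow_of_lt (by linarith) hz,
          show -2 - 2 * σ + 1 = -(2 * σ + 1) by ring, neg_div_neg_eq]
        ring_nf
    _ = _ := by
        rw [hardyKernel_eq σ hz hy, if_pos hyz, show -1 - σ = (-1 - 2 * σ) + σ by ring,
          Real.rpow_add hz]
        ring

lemma integral_hardyKernel_mul {σ : ℝ} (hσ : 0 ≤ σ) {y z : ℝ} (hy : 0 < y) (hz : 0 < z)
    (hyz : y ≠ z) : ∫ x in Set.Ioi (0 : ℝ), hardyKernel σ x y * hardyKernel σ x z =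
      (2 * σ + 1)⁻¹ * (hardyKernel σ y z + hardyKernel σ z y) := by
  rcases hyz.lt_or_gt with h | h
  · rw [integral_hardyKernel_mul_of_lt hσ hy h]
    simp [hardyKernel, h.not_gt]
  · simp_rw [mul_comm (hardyKernel σ _ y)]
    rw [integral_hardyKernel_mul_of_lt hσ hz h]
    simp [hardyKernel, h.not_gt]

/-- On `(0,1)`, the power `y ^ c` cut off at `1` is an eigenfunction of the Hardy kernel. -/
lemma integral_hardyKernel_mul_cpow {σ : ℝ} {c : ℂ} (hc : -1 < σ + c.re) {x : ℝ}
    (hx : 0 < x) (hx1 : x < 1) :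
    ∫ y in Set.Ioi (0 : ℝ), (hardyKernel σ x y : ℂ) *
      (Set.Ioo (0 : ℝ) 1).indicator (fun y : ℝ => (y : ℂ) ^ c) y = (σ + c + 1)⁻¹ * (x : ℂ) ^ c := by
  have hx0 : (x : ℂ) ≠ 0 := by exact_mod_cast hx.ne'
  have hre : (σ + c + 1).re ≠ 0 := by
    simp only [Complex.add_re, Complex.ofReal_re, Complex.one_re]; linarith
  have h0 : (σ + c + 1 : ℂ) ≠ 0 := fun h => hre (by rw [h, Complex.zero_re])
  calc _ = ∫ y in Set.Ioi (0 : ℝ), (Set.Iio x).indicator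
          (fun y : ℝ => (x : ℂ) ^ (-1 - σ : ℂ) * (y : ℂ) ^ (σ + c)) y := by
        refine setIntegral_congr_fun measurableSet_Ioi fun y hy => ?_
        have hy : 0 < y := hy
        simp only [Set.indicator_apply, Set.mem_Iio, Set.mem_Ioo]
        rw [hardyKernel_eq σ hx hy]
        by_cases h : y < x
        · rw [if_pos h, if_pos ⟨hy, h.trans hx1⟩, if_pos h,
            Complex.cpow_add _ _ (by exact_mod_cast hy.ne'), Complex.ofReal_mul,
            Complex.ofReal_cpow hx.le, Complex.ofReal_cpow hy.le]
          push_cast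
          ring
        · simp [h]
    _ = (x : ℂ) ^ (-1 - σ : ℂ) * ((x : ℂ) ^ (σ + c + 1) / (σ + c + 1)) := by
        rw [integral_indicator measurableSet_Iio, Measure.restrict_restrict measurableSet_Iio,
          Set.inter_comm, Set.Ioi_inter_Iio, restrict_Ioo_eq_restrict_Ioc, integral_const_mul,
          ← intervalIntegral.integral_of_le hx.le,
          integral_cpow (Or.inl (by simpa using hc)), Complex.ofReal_zero,
          Complex.zero_cpow h0, sub_zero]
    _ = _ := by
        rw [mul_div_assoc', ← Complex.cpow_add _ _ hx0]
        ring_nf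

lemma memLp_indicator_cpow {c : ℂ} (hc : -1 / 2 < c.re) :
    MemLp ((Set.Ioo (0 : ℝ) 1).indicator fun y : ℝ => (y : ℂ) ^ c) 2
      (volume.restrict (Set.Ioi (0 : ℝ))) := by
  have hm : Measurable fun y : ℝ => (y : ℂ) ^ c := by fun_prop
  rw [memLp_two_iff_integrable_sq_norm (hm.indicator measurableSet_Ioo).aestronglyMeasurable]
  refine Integrable.integrableOn ?_
  have hint : IntegrableOn (fun y : ℝ => y ^ (2 * c.re)) (Set.Ioo 0 1) :=
    ((intervalIntegrable_iff_integrableOn_Ioo_of_le zero_le_one).1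
      (intervalIntegral.intervalIntegrable_rpow' (by linarith)))
  refine (hint.integrable_indicator measurableSet_Ioo).congr (.of_forall fun y => ?_)
  by_cases h : y ∈ Set.Ioo (0 : ℝ) 1
  · simp only [Set.indicator_of_mem h, Complex.norm_cpow_eq_rpow_re_of_pos h.1]
    rw [← Real.rpow_natCast, ← Real.rpow_mul h.1.le]
    push_cast
    ring_nf
  · simp [h]

lemma toLp_indicator_cpow_ne_zero {c : ℂ} (hc : -1 / 2 < c.re) :
    (memLp_indicator_cpow hc).toLp ≠ 0 := by
  intro h
  have hae := (Lp.eq_zero_iff_ae_eq_zero.1 h).symm.trans (memLp_indicator_cpow hc).coeFn_toLp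
  have hae' := ae_restrict_of_ae_restrict_of_subset
    (fun x (hx : x ∈ Set.Ioo (0 : ℝ) 1) => hx.1) hae
  have hfalse : ∀ᵐ x ∂volume.restrict (Set.Ioo (0 : ℝ) 1), False := by
    filter_upwards [hae', ae_restrict_mem measurableSet_Ioo] with x h₁ hx
    rw [Set.indicator_of_mem hx, Pi.zero_apply, eq_comm, Complex.cpow_eq_zero_iff] at h₁
    exact hx.1.ne' (by exact_mod_cast h₁.1)
  have hzero : volume (Set.Ioo (0 : ℝ) 1) = 0 := by
    simpa only [ae_iff, not_false_eq_true, Set.ofPred_true, Measure.restrict_apply_univ] using hfalse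
  simp at hzero

theorem stmt_1 (σ : ℝ) (hσ : 0 ≤ σ) :
    ∃ T : Lp ℂ 2 (volume.restrict (Set.Ioi (0 : ℝ))) →L[ℂ]
          Lp ℂ 2 (volume.restrict (Set.Ioi (0 : ℝ))),
      ‖T‖ = 2 / (2 * σ + 1) ∧
      ∀ f : Lp ℂ 2 (volume.restrict (Set.Ioi (0 : ℝ))),
        ∀ᵐ x ∂(volume.restrict (Set.Ioi (0 : ℝ))),
          T f x = ∫ y in Set.Ioi (0 : ℝ),
            (if x < y then -(Complex.I / (y : ℂ)) * (((x / y) ^ σ : ℝ) : ℂ)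
             else if y < x then (Complex.I / (x : ℂ)) * (((y / x) ^ σ : ℝ) : ℂ)
             else 0) * f y := by
  obtain ⟨hk, hk'⟩ := isL2Kernel_hardyKernel hσ
  obtain ⟨H, hH⟩ := hk.exists_clm
  obtain ⟨H', hH'⟩ := hk'.exists_clm
  have hadj := hk.inner_left_eq hH hH'
  have hstar : star H = H' := by
    rw [ContinuousLinearMap.star_eq_adjoint]
    exact ((ContinuousLinearMap.eq_adjoint_iff _ _).2 hadj).symm
  have hcomp : ((2 * σ + 1 : ℝ) : ℂ) • (star H * H) = H + star H := by
    rw [hstar]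
    ext1 f
    ext1
    have hne : ((2 * σ + 1 : ℝ) : ℂ) ≠ 0 := by
      exact_mod_cast (by linarith : (2 * σ + 1 : ℝ) ≠ 0)
    filter_upwards [IsL2Kernel.comp_ae_eq hk' hk hH' hH f, hH f, hH' f, hk.ae_integrable f,
      hk'.ae_integrable f, Lp.coeFn_smul ((2 * σ + 1 : ℝ) : ℂ) (H' (H f)),
      Lp.coeFn_add (H f) (H' f), ae_restrict_mem measurableSet_Ioi]
      with y h₁ h₂ h₃ h₄ h₅ h₆ h₇ (hy : 0 < y)
    change (((2 * σ + 1 : ℝ) : ℂ) • H' (H f)) y = (H f + H' f) y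
    rw [h₆, h₇, Pi.smul_apply, Pi.add_apply, h₁, h₂, h₃, ← integral_add h₄ h₅, ← integral_smul]
    refine integral_congr_ae ?_
    filter_upwards [ae_restrict_mem measurableSet_Ioi,
      ae_restrict_of_ae (Measure.ae_ne volume y)] with z hz hzy
    rw [integral_hardyKernel_mul hσ hy hz hzy.symm, smul_eq_mul, Complex.ofReal_mul,
      Complex.ofReal_inv, ← mul_assoc, mul_inv_cancel_left₀ hne, Complex.ofReal_add, add_mul]
  refine ⟨Complex.I • (H - H'), ?_, fun f => ?_⟩
  · rw [norm_smul, Complex.norm_I, one_mul]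
    refine le_antisymm (hstar ▸ norm_sub_star_le (by linarith) hcomp) ?_
    set a : ℝ := σ + 1 / 2 with ha
    have ha0 : 0 < a := by positivity
    have lower : ∀ ε : ℝ, 0 < ε → 2 * (a / ((a + ε) ^ 2 + a ^ 2)) ≤ ‖H - H'‖ := by
      intro ε hε
      set c : ℂ := ⟨-1 / 2 + ε, a⟩ with hcdef
      have hc : -1 / 2 < c.re := by simp [hcdef, hε]
      set f := (memLp_indicator_cpow hc).toLp
      have hf : f =ᵐ[volume.restrict (Set.Ioi (0 : ℝ))] _ :=
        (memLp_indicator_cpow hc).coeFn_toLp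
      have heig : ⟪f, H f⟫_ℂ = (σ + c + 1)⁻¹ * ⟪f, f⟫_ℂ := by
        rw [← inner_smul_right, L2.inner_def, L2.inner_def]
        refine integral_congr_ae ?_
        filter_upwards [hH f, hf, Lp.coeFn_smul ((σ + c + 1)⁻¹ : ℂ) f,
          ae_restrict_mem measurableSet_Ioi] with x h₁ h₂ h₃ hx
        rw [h₃, Pi.smul_apply]
        by_cases hx1 : x < 1
        · have : (H f) x = (σ + c + 1 : ℂ)⁻¹ • f x := by
            rw [h₁, h₂,
              Set.indicator_of_mem (show x ∈ Set.Ioo (0 : ℝ) 1 from ⟨hx, hx1⟩), smul_eq_mul,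
              ← integral_hardyKernel_mul_cpow (σ := σ) (c := c) (by linarith) hx hx1]
            refine integral_congr_ae ?_
            filter_upwards [hf] with y hy
            rw [hy]
          rw [this]
        · have : f x = 0 := by rw [h₂, Set.indicator_of_notMem fun h => hx1 h.2]
          simp [this]
      have key := two_mul_im_le_norm_sub hadj (toLp_indicator_cpow_ne_zero hc) heig
      refine le_trans (le_of_eq ?_) key
      have hs : (σ + c + 1 : ℂ) = ⟨a + ε, a⟩ := by
        apply Complex.ext
        · simp [hcdef, ha]; ring
        · simp [hcdef]
      rw [hs, Complex.inv_im, Complex.normSq_mk, neg_div, abs_neg,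
        abs_of_nonneg (by positivity)]
      ring
    have hlim : Filter.Tendsto (fun ε : ℝ => 2 * (a / ((a + ε) ^ 2 + a ^ 2)))
        (nhdsWithin 0 (Set.Ioi 0)) (nhds (2 * (a / ((a + 0) ^ 2 + a ^ 2)))) := by
      refine (ContinuousAt.tendsto ?_).mono_left nhdsWithin_le_nhds
      have : (a + 0) ^ 2 + a ^ 2 ≠ 0 := by positivity
      fun_prop (disch := assumption)
    have hge := le_of_tendsto hlim (Filter.eventually_of_mem self_mem_nhdsWithin lower)
    refine le_trans (le_of_eq ?_) hge
    rw [show 2 * σ + 1 = 2 * a by rw [ha]; ring]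
    field_simp
    ring
  · filter_upwards [hH f, hH' f, hk.ae_integrable f, hk'.ae_integrable f,
      Lp.coeFn_smul Complex.I (H f - H' f), Lp.coeFn_sub (H f) (H' f)] with x h₁ h₂ h₃ h₄ h₅ h₆
    change (Complex.I • (H f - H' f)) x = _
    rw [h₅, Pi.smul_apply, h₆, Pi.sub_apply, h₁, h₂, ← integral_sub h₃ h₄, ← integral_smul]
    congr with y
    rw [smul_eq_mul, ← sub_mul, ← mul_assoc]
    congr 1
    unfold hardyKernel
    rcases lt_trichotomy x y with h | h | h
    · simp [h, h.not_gt]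
      ring
    · simp [h]
    · simp [h, h.not_gt]
      ring
end

section
/- For every real w > 0 one has sinh(w)² − w² > 0 and (sinh(w)·cosh(w) − w)/(sinh(w)² − w²) ≤ 4·coth(w). -/
/-- The quadratic Taylor lower bound for `cosh` at `0`. -/
theorem one_add_sq_div_two_le_cosh {x : ℝ} (hx : 0 ≤ x) : 1 + x ^ 2 / 2 ≤ Real.cosh x := by
  have h := Real.cosh_two_mul (x / 2)
  rw [mul_div_cancel₀ x two_ne_zero, Real.cosh_sq] at h
  have hs : x / 2 ≤ Real.sinh (x / 2) := Real.self_le_sinh_iff.2 (by positivity)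
  nlinarith [mul_self_le_mul_self (by positivity) hs]

theorem mul_one_add_sq_div_eight_le_sinh {x : ℝ} (hx : 0 ≤ x) :
    x * (1 + x ^ 2 / 8) ≤ Real.sinh x := by
  have h := Real.sinh_two_mul (x / 2)
  rw [mul_div_cancel₀ x two_ne_zero] at h
  have hs : x / 2 ≤ Real.sinh (x / 2) := Real.self_le_sinh_iff.2 (by positivity)
  have hc := one_add_sq_div_two_le_cosh (x := x / 2) (by positivity)
  nlinarith [mul_le_mul hs hc (by positivity) (by linarith)]

theorem cosh_mul_one_sub_le_one (x : ℝ) : Real.cosh x * (1 - 3 / 4 * x ^ 2) ≤ 1 := by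
  have hc : Real.cosh x ≤ Real.exp (x ^ 2 / 2) := Real.cosh_le_exp_half_sq x
  have he := Real.add_one_le_exp (-(3 / 4 * x ^ 2))
  calc Real.cosh x * (1 - 3 / 4 * x ^ 2)
      ≤ Real.cosh x * Real.exp (-(3 / 4 * x ^ 2)) :=
        mul_le_mul_of_nonneg_left (by linarith) (Real.cosh_pos x).le
    _ ≤ Real.exp (x ^ 2 / 2) * Real.exp (-(3 / 4 * x ^ 2)) := by gcongr
    _ ≤ 1 := by
        rw [← Real.exp_add, Real.exp_le_one_iff]
        nlinarith [sq_nonneg x]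

/-- For every real `w > 0`, `sinh(w)² − w² > 0` and
`(sinh(w)·cosh(w) − w)/(sinh(w)² − w²) ≤ 4·coth(w)`. -/
theorem stmt_2 (w : ℝ) (hw : 0 < w) :
    0 < Real.sinh w ^ 2 - w ^ 2 ∧
    (Real.sinh w * Real.cosh w - w) / (Real.sinh w ^ 2 - w ^ 2) ≤
      4 * (Real.cosh w / Real.sinh w) := by
  have hlt : w < Real.sinh w := Real.self_lt_sinh_iff.2 hw
  have hpos : 0 < Real.sinh w ^ 2 - w ^ 2 := by nlinarith
  refine ⟨hpos, ?_⟩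
  have hs := mul_one_add_sq_div_eight_le_sinh hw.le
  have hsq : w ^ 2 * (1 + w ^ 2 / 4) ≤ Real.sinh w ^ 2 := by
    have h := pow_le_pow_left₀ (by positivity) hs 2
    nlinarith [sq_nonneg (w ^ 3)]
  have hcosh_sq := mul_le_mul_of_nonneg_left hsq (Real.cosh_pos w).le
  have hmul := mul_le_mul_of_nonneg_left hlt.le hw.le
  have hcosh := mul_le_mul_of_nonneg_left (cosh_mul_one_sub_le_one w) (sq_nonneg w)
  rw [← mul_div_assoc, div_le_div_iff₀ hpos (hw.trans hlt)]
  linarith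
end

section
/- For every integer n ≥ 1 and every real σ ≥ 0, setting w = (σ + 1/2)·ln(1 + 1/n), one has ((2σ+1)/n) · (sinh(w)·cosh(w) − w)/(sinh(w)² − w²) ≤ 12·(2σ+1). -/
theorem nonneg_of_hasDerivAt_nonneg_of_zero {f f' : ℝ → ℝ} (h0 : f 0 = 0)
    (hf : ∀ x, HasDerivAt f (f' x) x) (hf' : ∀ x, 0 ≤ x → 0 ≤ f' x) (x : ℝ) (hx : 0 ≤ x) :
    0 ≤ f x := by
  have hmono : MonotoneOn f (Set.Ici 0) := by
    refine monotoneOn_of_deriv_nonneg (convex_Ici 0)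
      (fun y _ => (hf y).continuousAt.continuousWithinAt)
      (fun y _ => (hf y).differentiableAt.differentiableWithinAt) fun y hy => ?_
    rw [(hf y).deriv]
    exact hf' y (interior_subset hy)
  simpa [h0] using hmono Set.self_mem_Ici (Set.mem_Ici.2 hx) hx

theorem hasDerivAt_affine_mul_cosh_add_affine_mul_sinh_add_cubic
    (a b c d p q r s x : ℝ) :
    HasDerivAt (fun x => (a + b * x) * Real.cosh x + (c + d * x) * Real.sinh x +
        (p + q * x + r * x ^ 2 + s * x ^ 3))
      ((b + c + d * x) * Real.cosh x + (a + d + b * x) * Real.sinh x +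
        (q + 2 * r * x + 3 * s * x ^ 2)) x := by
  have affine (u v : ℝ) : HasDerivAt (fun x : ℝ => u + v * x) v x := by
    simpa using ((hasDerivAt_id x).const_mul v).const_add u
  have h := (((affine a b).mul (Real.hasDerivAt_cosh x)).add
    ((affine c d).mul (Real.hasDerivAt_sinh x))).add
    (((affine p q).add ((hasDerivAt_pow 2 x).const_mul r)).add ((hasDerivAt_pow 3 x).const_mul s))
  refine h.congr_deriv ?_
  norm_num
  ring

/-- The inequality behind the bound `(sinh w cosh w - w) / (sinh² w - w²) ≤ 2 / w + 4`,
written in terms of `x = 2 * w`. -/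
theorem mul_sinh_sub_self_le {x : ℝ} (hx : 0 ≤ x) :
    x * (Real.sinh x - x) ≤ (1 + x) * (4 * (Real.cosh x - 1) - 2 * x ^ 2) := by
  have h4 (x : ℝ) (hx : 0 ≤ x) :
      0 ≤ 4 * x * Real.cosh x + (16 - x) * Real.sinh x := by
    have hs := Real.sinh_nonneg_iff.2 hx
    nlinarith [mul_nonneg hx (sub_nonneg.2 (Real.sinh_lt_cosh x).le), mul_nonneg hx hs]
  have h3 := nonneg_of_hasDerivAt_nonneg_of_zero (by norm_num)
    (hasDerivAt_affine_mul_cosh_add_affine_mul_sinh_add_cubic 12 (-1) 1 4 (-12) 0 0 0)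
    fun x hx => (h4 x hx).trans_eq (by ring)
  have h2 := nonneg_of_hasDerivAt_nonneg_of_zero (by norm_num)
    (hasDerivAt_affine_mul_cosh_add_affine_mul_sinh_add_cubic 2 4 8 (-1) (-2) (-12) 0 0)
    fun x hx => (h3 x hx).trans_eq (by ring)
  have h1 := nonneg_of_hasDerivAt_nonneg_of_zero (by norm_num)
    (hasDerivAt_affine_mul_cosh_add_affine_mul_sinh_add_cubic 4 (-1) 3 4 (-4) (-2) (-6) 0)
    fun x hx => (h2 x hx).trans_eq (by ring)
  have h0 := nonneg_of_hasDerivAt_nonneg_of_zero (by norm_num)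
    (hasDerivAt_affine_mul_cosh_add_affine_mul_sinh_add_cubic 4 4 0 (-1) (-4) (-4) (-1) (-2))
    fun x hx => (h1 x hx).trans_eq (by ring)
  linarith [h0 x hx]

theorem sinh_mul_cosh_sub_self_div_le {w : ℝ} (hw : 0 < w) :
    (Real.sinh w * Real.cosh w - w) / (Real.sinh w ^ 2 - w ^ 2) ≤ 2 / w + 4 := by
  have hpos : 0 < Real.sinh w ^ 2 - w ^ 2 :=
    sub_pos.2 (pow_lt_pow_left₀ (Real.self_lt_sinh_iff.2 hw) hw.le two_ne_zero)
  have h := mul_sinh_sub_self_le (mul_nonneg zero_le_two hw.le)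
  rw [Real.sinh_two_mul, Real.cosh_two_mul, Real.cosh_sq] at h
  rw [div_le_iff₀ hpos, ← mul_le_mul_iff_right₀ hw]
  have : w * ((2 / w + 4) * (Real.sinh w ^ 2 - w ^ 2)) =
      (2 + 4 * w) * (Real.sinh w ^ 2 - w ^ 2) := by
    field_simp
  linarith


/-- For every integer `n ≥ 1` and real `σ ≥ 0`, with
`w = (σ + 1/2)·ln(1 + 1/n)`, one has
`((2σ+1)/n)·(sinh(w)cosh(w) − w)/(sinh(w)² − w²) ≤ 12(2σ+1)`. -/
theorem stmt_3 (n : ℕ) (hn : 1 ≤ n) (σ : ℝ) (hσ : 0 ≤ σ) :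
    ((2 * σ + 1) / (n : ℝ)) *
        ((Real.sinh ((σ + 1 / 2) * Real.log (1 + 1 / (n : ℝ))) *
            Real.cosh ((σ + 1 / 2) * Real.log (1 + 1 / (n : ℝ))) -
            (σ + 1 / 2) * Real.log (1 + 1 / (n : ℝ))) /
          (Real.sinh ((σ + 1 / 2) * Real.log (1 + 1 / (n : ℝ))) ^ 2 -
            ((σ + 1 / 2) * Real.log (1 + 1 / (n : ℝ))) ^ 2)) ≤
      12 * (2 * σ + 1) := by
  have hn1 : (1 : ℝ) ≤ n := by exact_mod_cast hn
  have hn0 : (0 : ℝ) < n := by linarith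
  have hlog : 1 / (2 * (n : ℝ)) ≤ Real.log (1 + 1 / (n : ℝ)) := by
    refine le_trans ?_ (Real.one_sub_inv_le_log_of_pos (by positivity))
    have : 1 - (1 + 1 / (n : ℝ))⁻¹ = 1 / (n + 1) := by
      field_simp
      ring
    rw [this]
    exact one_div_le_one_div_of_le (by linarith) (by linarith)
  have hw : 1 / (4 * (n : ℝ)) ≤ (σ + 1 / 2) * Real.log (1 + 1 / (n : ℝ)) :=
    calc 1 / (4 * (n : ℝ)) = 1 / 2 * (1 / (2 * (n : ℝ))) := by ring
      _ ≤ _ := mul_le_mul (by linarith) hlog (by positivity) (by linarith)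
  set w := (σ + 1 / 2) * Real.log (1 + 1 / (n : ℝ))
  have hw0 : 0 < w := lt_of_lt_of_le (by positivity) hw
  have hdiv : 2 / w ≤ 8 * n := by
    rw [div_le_iff₀ (by positivity)] at hw
    rw [div_le_iff₀ hw0]
    linarith
  have hbound := sinh_mul_cosh_sub_self_div_le hw0
  calc _ ≤ (2 * σ + 1) / n * (12 * n) :=
        mul_le_mul_of_nonneg_left (by linarith) (by positivity)
    _ = 12 * (2 * σ + 1) := by field_simp
end

section
/- One has ∫₀^∞ y/sinh(y/2) dy = π², and for every σ ∈ [0,1] the inequality 2·∫₀^∞ ((1 − e^{−σy})/(1 − e^{−y}))·e^{−y/2} dy ≤ π²·σ holds. -/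
open MeasureTheory

theorem hasSum_one_div_odd_sq :
    HasSum (fun n : ℕ => (1 : ℝ) / (2 * n + 1) ^ 2) (Real.pi ^ 2 / 8) := by
  have hz := hasSum_zeta_two
  have heven : HasSum (fun n : ℕ => (1 : ℝ) / ((2 * n : ℕ) : ℝ) ^ 2) (Real.pi ^ 2 / 24) := by
    convert! hz.mul_left (1 / 4) using 1
    · ext n
      push_cast
      rw [mul_pow, one_div_mul_one_div]
      norm_num
    · ring
  have hodd : Summable (fun n : ℕ => (1 : ℝ) / ((2 * n + 1 : ℕ) : ℝ) ^ 2) :=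
    hz.summable.comp_injective (i := fun n : ℕ => 2 * n + 1) fun a b h => by
      dsimp only at h
      omega
  have hsum := (HasSum.even_add_odd (f := fun n : ℕ => (1 : ℝ) / (n : ℝ) ^ 2)
    heven hodd.hasSum).unique hz
  have hval : ∑' n : ℕ, (1 : ℝ) / ((2 * n + 1 : ℕ) : ℝ) ^ 2 = Real.pi ^ 2 / 8 := by linarith
  rw [← hval]
  exact_mod_cast hodd.hasSum

theorem integral_mul_exp_neg_mul_Ioi {a : ℝ} (ha : 0 < a) :
    ∫ y in Set.Ioi (0 : ℝ), y * Real.exp (-(a * y)) = 1 / a ^ 2 := by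
  simpa [show (2 : ℝ) - 1 = 1 by norm_num] using
    Real.integral_rpow_mul_exp_neg_mul_Ioi (a := 2) two_pos ha

theorem integrableOn_mul_exp_neg_mul_Ioi {a : ℝ} (ha : 0 < a) :
    IntegrableOn (fun y => y * Real.exp (-(a * y))) (Set.Ioi (0 : ℝ)) := by
  refine Integrable.of_integral_ne_zero ?_
  rw [integral_mul_exp_neg_mul_Ioi ha]
  positivity

theorem inv_sinh_half_eq {y : ℝ} (hy : 0 < y) :
    (Real.sinh (y / 2))⁻¹ = 2 * (Real.exp (-y / 2) / (1 - Real.exp (-y))) := by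
  have h1 : Real.exp (-y) = Real.exp (-y / 2) * Real.exp (-y / 2) := by
    rw [← Real.exp_add]
    ring_nf
  have h2 : Real.exp (y / 2) * Real.exp (-y / 2) = 1 := by
    rw [← Real.exp_add]
    ring_nf
    simp
  have h3 : 1 - Real.exp (-y) ≠ 0 := by
    have : Real.exp (-y) < 1 := Real.exp_lt_one_iff.2 (by linarith)
    linarith
  have h4 : Real.sinh (y / 2) ≠ 0 := (Real.sinh_pos_iff.2 (by linarith)).ne'
  have h5 : 2 * Real.sinh (y / 2) * Real.exp (-y / 2) = 1 - Real.exp (-y) := by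
    rw [Real.sinh_eq, h1, ← neg_div]
    linear_combination h2
  rw [inv_eq_one_div, div_eq_iff h4, mul_div_assoc', div_mul_eq_mul_div, eq_div_iff h3]
  linear_combination -h5

theorem hasSum_div_sinh_half {y : ℝ} (hy : 0 < y) :
    HasSum (fun n : ℕ => 2 * (y * Real.exp (-((n + 1 / 2) * y)))) (y / Real.sinh (y / 2)) := by
  have hg := (hasSum_geometric_of_lt_one (Real.exp_pos (-y)).le
    (Real.exp_lt_one_iff.2 (by linarith))).mul_left (2 * y * Real.exp (-y / 2))
  convert! hg using 1
  · ext n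
    rw [← Real.exp_nat_mul, mul_assoc, mul_assoc, ← Real.exp_add]
    ring_nf
  · rw [div_eq_mul_inv, inv_sinh_half_eq hy]
    ring

theorem integral_div_sinh_half :
    ∫ y in Set.Ioi (0 : ℝ), y / Real.sinh (y / 2) = Real.pi ^ 2 := by
  have hint (n : ℕ) : ∫ y in Set.Ioi (0 : ℝ), 2 * (y * Real.exp (-(((n : ℝ) + 1 / 2) * y))) =
      8 * (1 / (2 * n + 1) ^ 2) := by
    rw [integral_const_mul, integral_mul_exp_neg_mul_Ioi (by positivity)]
    field_simp
    ring
  have hsum : HasSum (fun n : ℕ => 8 * ((1 : ℝ) / (2 * n + 1) ^ 2)) (Real.pi ^ 2) := by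
    convert! hasSum_one_div_odd_sq.mul_left 8 using 1
    ring
  have hmain := hasSum_integral_of_summable_integral_norm
    (μ := volume.restrict (Set.Ioi (0 : ℝ)))
    (F := fun (n : ℕ) y => 2 * (y * Real.exp (-(((n : ℝ) + 1 / 2) * y))))
    (fun n => (integrableOn_mul_exp_neg_mul_Ioi (by positivity)).const_mul 2) (by
      convert! hsum.summable using 2 with n
      rw [← hint n]
      refine setIntegral_congr_fun measurableSet_Ioi fun y hy => ?_
      have : 0 < y := hy
      exact Real.norm_of_nonneg (by positivity))
  simp only [hint] at hmain
  rw [← hmain.unique hsum]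
  exact setIntegral_congr_fun measurableSet_Ioi fun y hy => (hasSum_div_sinh_half hy).tsum_eq.symm

theorem integrableOn_div_sinh_half :
    IntegrableOn (fun y => y / Real.sinh (y / 2)) (Set.Ioi (0 : ℝ)) := by
  refine Integrable.of_integral_ne_zero ?_
  rw [integral_div_sinh_half]
  positivity

/-- `∫₀^∞ y/sinh(y/2) dy = π²`, and for every `σ ∈ [0,1]`,
`2·∫₀^∞ ((1 − e^{−σy})/(1 − e^{−y}))·e^{−y/2} dy ≤ π²·σ`. -/
theorem stmt_5 :
    (∫ y in Set.Ioi (0 : ℝ), y / Real.sinh (y / 2)) = Real.pi ^ 2 ∧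
    ∀ σ : ℝ, σ ∈ Set.Icc (0 : ℝ) 1 →
      2 * (∫ y in Set.Ioi (0 : ℝ),
          ((1 - Real.exp (-σ * y)) / (1 - Real.exp (-y))) * Real.exp (-y / 2)) ≤
        Real.pi ^ 2 * σ := by
  refine ⟨integral_div_sinh_half, fun σ hσ => ?_⟩
  have hexp {y : ℝ} (hy : 0 < y) : 0 < 1 - Real.exp (-y) :=
    sub_pos.2 (Real.exp_lt_one_iff.2 (by linarith))
  have hle : ∫ y in Set.Ioi (0 : ℝ),
      ((1 - Real.exp (-σ * y)) / (1 - Real.exp (-y))) * Real.exp (-y / 2) ≤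
      ∫ y in Set.Ioi (0 : ℝ), σ / 2 * (y / Real.sinh (y / 2)) := by
    refine integral_mono_of_nonneg ?_ (integrableOn_div_sinh_half.const_mul _) ?_
    all_goals
      refine (ae_restrict_mem measurableSet_Ioi).mono fun y hy => ?_
      have hy : 0 < y := hy
      have hpos := hexp hy
      dsimp only [Pi.zero_apply]
    · have hnum : 0 ≤ 1 - Real.exp (-σ * y) :=
        sub_nonneg.2 (Real.exp_le_one_iff.2 (by nlinarith [hσ.1]))
      positivity
    · have hnum : 1 - Real.exp (-σ * y) ≤ σ * y := by
        linarith [Real.add_one_le_exp (-σ * y)]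
      rw [div_eq_mul_inv y, inv_sinh_half_eq hy]
      calc _ = (1 - Real.exp (-σ * y)) * (Real.exp (-y / 2) / (1 - Real.exp (-y))) := by ring
        _ ≤ σ * y * (Real.exp (-y / 2) / (1 - Real.exp (-y))) := by gcongr
        _ = _ := by ring
  rw [integral_const_mul, integral_div_sinh_half] at hle
  linarith
end

section
/- Let σ ∈ [0,1] and let x, y be real numbers with 0 < ⌊x⌋ < ⌊y⌋, where ⌊·⌋ denotes the integer part. Then 0 ≤ (1/⌊y⌋)·f_σ(⌊x⌋/⌊y⌋) − (1/y)·f_σ(x/y) ≤ 2σ/(⌊x⌋·(⌊y⌋ − ⌊x⌋)). -/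
theorem secant_rpow_antitone {σ s t : ℝ} (h0 : 0 ≤ σ) (h1 : σ ≤ 1) (hs : 0 ≤ s)
    (hs1 : s ≠ 1) (ht1 : t ≠ 1) (hst : s ≤ t) :
    (t ^ σ - 1) / (t - 1) ≤ (s ^ σ - 1) / (s - 1) := by
  have h := (Real.concaveOn_rpow h0 h1).neg.secant_mono (a := 1) (x := s) (y := t)
    (by simp) hs (hs.trans hst) hs1 ht1 hst
  have key (u : ℝ) : (-u ^ σ - -(1 : ℝ) ^ σ) / (u - 1) = -((u ^ σ - 1) / (u - 1)) := by
    rw [Real.one_rpow]; ring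
  simp only [Pi.neg_apply, key] at h
  linarith

theorem one_sub_div_rpow_div_sub_anti {σ x y x' y' : ℝ} (h0 : 0 ≤ σ) (h1 : σ ≤ 1)
    (hx : 0 < x) (hxy : x < y) (hxy' : x' < y') (hxx : x ≤ x') (hyy : y ≤ y') :
    (1 - (x' / y') ^ σ) / (y' - x') ≤ (1 - (x / y) ^ σ) / (y - x) := by
  have hy : 0 < y := hx.trans hxy
  have hy' : 0 < y' := hy.trans_le hyy
  have hlt : x < y' := hxy.trans_le hyy
  have left (u v : ℝ) (hv : 0 < v) (huv : u < v) :
      (1 - (u / v) ^ σ) / (v - u) = v⁻¹ * (((u / v) ^ σ - 1) / (u / v - 1)) := by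
    have : v - u ≠ 0 := by linarith
    have : u - v ≠ 0 := by linarith
    have : u / v - 1 = -(v - u) / v := by field_simp; ring
    rw [this]; field_simp; ring
  have right (v : ℝ) (huv : x < v) :
      (1 - (x / v) ^ σ) / (v - x) = x⁻¹ * (((v / x) ^ σ - 1) / (v / x - 1) * (x / v) ^ σ) := by
    have hv : 0 < v := hx.trans huv
    have : v - x ≠ 0 := by linarith
    have e : v / x - 1 = (v - x) / x := by field_simp
    have h : (v / x) ^ σ * (x / v) ^ σ = 1 := by
      rw [← Real.mul_rpow (by positivity) (by positivity), div_mul_div_cancel₀ hx.ne',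
        div_self hv.ne', Real.one_rpow]
    rw [e, div_mul_eq_mul_div, sub_mul, h]; field_simp
  calc (1 - (x' / y') ^ σ) / (y' - x') ≤ (1 - (x / y') ^ σ) / (y' - x) := by
        rw [left _ _ hy' hxy', left _ _ hy' hlt]
        refine mul_le_mul_of_nonneg_left ?_ (by positivity)
        exact secant_rpow_antitone h0 h1 (by positivity) ((div_lt_one hy').2 hlt).ne
          ((div_lt_one hy').2 hxy').ne (by gcongr)
    _ ≤ (1 - (x / y) ^ σ) / (y - x) := by
        rw [right _ hxy, right _ hlt]
        have hone : 1 < y / x := (one_lt_div hx).2 hxy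
        refine mul_le_mul_of_nonneg_left ?_ (by positivity)
        refine mul_le_mul ?_ (by gcongr) (by positivity) ?_
        · exact secant_rpow_antitone h0 h1 (by positivity) hone.ne'
            ((one_lt_div hx).2 hlt).ne' (by gcongr)
        · exact div_nonneg (sub_nonneg.2 (Real.one_le_rpow hone.le h0)) (by linarith)

theorem rpow_succ_div_succ_sub_le {σ m n : ℝ} (h0 : 0 ≤ σ) (h1 : σ ≤ 1)
    (hm : 0 < m) (hmn : m ≤ n) :
    ((m + 1) / (n + 1)) ^ σ - (m / n) ^ σ ≤ σ / m := by
  have hn : 0 < n := hm.trans_le hmn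
  have hb : (m / n) ^ σ ≤ 1 :=
    Real.rpow_le_one (by positivity) ((div_le_one hn).2 hmn) h0
  have hle : (m + 1) / (n + 1) ≤ m / n * (1 + 1 / m) := by
    have : m / n * (1 + 1 / m) = (m + 1) / n := by field_simp
    rw [this]; gcongr; linarith
  have hinv : 0 < 1 / m := by positivity
  have hbern : (1 + 1 / m) ^ σ ≤ 1 + σ * (1 / m) :=
    rpow_one_add_le_one_add_mul_self (by linarith) h0 h1
  calc ((m + 1) / (n + 1)) ^ σ - (m / n) ^ σ
      ≤ (m / n * (1 + 1 / m)) ^ σ - (m / n) ^ σ := by gcongr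
    _ = (m / n) ^ σ * ((1 + 1 / m) ^ σ - 1) := by
        rw [Real.mul_rpow (by positivity) (by positivity)]; ring
    _ ≤ (m / n) ^ σ * (σ * (1 / m)) := by gcongr; linarith
    _ ≤ 1 * (σ * (1 / m)) := by gcongr
    _ = σ / m := by ring

/-- For `σ ∈ [0,1]` and reals `x, y` with `0 < ⌊x⌋ < ⌊y⌋`, with
`f_σ(u) = (1 − u^σ)/(1 − u)`, one has
`0 ≤ (1/⌊y⌋)·f_σ(⌊x⌋/⌊y⌋) − (1/y)·f_σ(x/y) ≤ 2σ/(⌊x⌋·(⌊y⌋ − ⌊x⌋))`. -/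
theorem stmt_6 (σ x y : ℝ) (hσ : σ ∈ Set.Icc (0 : ℝ) 1)
    (hx : 0 < ⌊x⌋) (hxy : ⌊x⌋ < ⌊y⌋) :
    0 ≤ (1 / (⌊y⌋ : ℝ)) *
          ((1 - ((⌊x⌋ : ℝ) / (⌊y⌋ : ℝ)) ^ σ) / (1 - (⌊x⌋ : ℝ) / (⌊y⌋ : ℝ))) -
        (1 / y) * ((1 - (x / y) ^ σ) / (1 - x / y)) ∧
    (1 / (⌊y⌋ : ℝ)) *
          ((1 - ((⌊x⌋ : ℝ) / (⌊y⌋ : ℝ)) ^ σ) / (1 - (⌊x⌋ : ℝ) / (⌊y⌋ : ℝ))) -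
        (1 / y) * ((1 - (x / y) ^ σ) / (1 - x / y)) ≤
      2 * σ / ((⌊x⌋ : ℝ) * ((⌊y⌋ : ℝ) - (⌊x⌋ : ℝ))) := by
  obtain ⟨h0, h1⟩ := hσ
  have hm : (0 : ℝ) < ⌊x⌋ := by exact_mod_cast hx
  have hmn : (⌊x⌋ : ℝ) + 1 ≤ ⌊y⌋ := by exact_mod_cast hxy
  have hxf := Int.floor_le x
  have hxl := Int.lt_floor_add_one x
  have hyf := Int.floor_le y
  have hyl := Int.lt_floor_add_one y
  have form (u v : ℝ) (hv : 0 < v) :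
      (1 / v) * ((1 - (u / v) ^ σ) / (1 - u / v)) = (1 - (u / v) ^ σ) / (v - u) := by
    rw [div_mul_div_comm, one_mul, mul_sub, mul_one, mul_div_cancel₀ _ hv.ne']
  rw [form _ _ (by linarith), form _ _ (by linarith)]
  generalize (⌊x⌋ : ℝ) = m at *
  generalize (⌊y⌋ : ℝ) = n at *
  refine ⟨sub_nonneg.2 (one_sub_div_rpow_div_sub_anti h0 h1 hm (by linarith) (by linarith)
    hxf hyf), ?_⟩
  have hnm : 0 < n - m := by linarith
  have hshift := one_sub_div_rpow_div_sub_anti h0 h1 (hm.trans_le hxf)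
    (show x < y by linarith) (show m + 1 < n + 1 by linarith) hxl.le hyl.le
  rw [add_sub_add_right_eq_sub] at hshift
  calc (1 - (m / n) ^ σ) / (n - m) - (1 - (x / y) ^ σ) / (y - x)
      ≤ (1 - (m / n) ^ σ) / (n - m) - (1 - ((m + 1) / (n + 1)) ^ σ) / (n - m) := by gcongr
    _ = (((m + 1) / (n + 1)) ^ σ - (m / n) ^ σ) / (n - m) := by ring
    _ ≤ σ / m / (n - m) := by
        gcongr
        exact rpow_succ_div_succ_sub_le h0 h1 hm (by linarith)
    _ = σ / (m * (n - m)) := div_div _ _ _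
    _ ≤ 2 * σ / (m * (n - m)) := by gcongr; linarith
end

section
/- For every real σ ≥ 0, the infinite matrix A(σ) indexed by m,n ∈ ℕ = {1,2,3,…} with entries A(σ)_{mn} = 0 for m = n and A(σ)_{mn} = (i/(n−m))·min{(m/n)^σ, (n/m)^σ} for m ≠ n defines a bounded linear operator on ℓ²(ℕ), and its operator norm satisfies ‖A(σ)‖ ≤ π + (√2/3 + 4)·π²·σ. -/
open Complex ComplexConjugate Finset in
/-- `C` bounds the sesquilinear form of the infinite matrix `A` on finitely supported vectors. -/
def FiniteFormBound {ι : Type*} (A : ι → ι → ℂ) (C : ℝ) : Prop :=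
  ∀ (F G : Finset ι) (x y : ι → ℂ),
    ‖∑ m ∈ F, ∑ n ∈ G, conj (y m) * A m n * x n‖ ≤
      C / 2 * (∑ n ∈ G, ‖x n‖ ^ 2 + ∑ m ∈ F, ‖y m‖ ^ 2)

namespace FiniteFormBound

open Complex ComplexConjugate Finset Filter Topology

variable {ι : Type*} {A : ι → ι → ℂ} {C : ℝ}

/-- Schur multiplication by a Gram matrix of unit vectors preserves form bounds. -/
lemma schur_mul {κ : Type*} (hA : FiniteFormBound A C) (w : ι → ι → ℝ)
    (hw : ∀ F : Finset ι, ∃ (K : Finset κ) (φ : κ → ι → ℝ),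
      (∀ m ∈ F, ∀ n ∈ F, w m n = ∑ k ∈ K, φ k m * φ k n) ∧ ∀ m ∈ F, ∑ k ∈ K, φ k m ^ 2 = 1) :
    FiniteFormBound (fun m n => A m n * (w m n : ℂ)) C := by
  classical
  intro F G x y
  obtain ⟨K, φ, hφ, hφ1⟩ := hw (F ∪ G)
  have sum_sq : ∀ (S : Finset ι) (z : ι → ℂ), S ⊆ F ∪ G →
      ∑ k ∈ K, ∑ n ∈ S, ‖(φ k n : ℂ) * z n‖ ^ 2 = ∑ n ∈ S, ‖z n‖ ^ 2 := by
    intro S z hS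
    rw [sum_comm]
    refine sum_congr rfl fun n hn => ?_
    simp only [norm_mul, mul_pow, norm_real, Real.norm_eq_abs, sq_abs]
    rw [← sum_mul, hφ1 n (hS hn), one_mul]
  have key : ∑ k ∈ K, ∑ m ∈ F, ∑ n ∈ G,
        conj ((φ k m : ℂ) * y m) * A m n * ((φ k n : ℂ) * x n) =
      ∑ m ∈ F, ∑ n ∈ G, conj (y m) * (A m n * (w m n : ℂ)) * x n := by
    rw [sum_comm]
    refine sum_congr rfl fun m hm => ?_
    rw [sum_comm]
    refine sum_congr rfl fun n hn => ?_
    rw [hφ m (mem_union_left _ hm) n (mem_union_right _ hn)]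
    push_cast
    simp only [mul_sum, sum_mul, map_mul, conj_ofReal]
    exact sum_congr rfl fun k _ => by ring
  rw [← key]
  calc _ ≤ ∑ k ∈ K, C / 2 * (∑ n ∈ G, ‖(φ k n : ℂ) * x n‖ ^ 2
          + ∑ m ∈ F, ‖(φ k m : ℂ) * y m‖ ^ 2) :=
        norm_sum_le_of_le _ fun k _ => hA F G _ _
    _ = _ := by
        rw [← mul_sum, sum_add_distrib, sum_sq G x subset_union_right,
          sum_sq F y subset_union_left]

lemma sum_norm_sq_le (hA : FiniteFormBound A C) (hC : 0 < C) (F G : Finset ι) (x : ι → ℂ) :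
    ∑ m ∈ F, ‖∑ n ∈ G, A m n * x n‖ ^ 2 ≤ C ^ 2 * ∑ n ∈ G, ‖x n‖ ^ 2 := by
  set v : ι → ℂ := fun m => ∑ n ∈ G, A m n * x n
  have h := hA F G x (fun m => (C⁻¹ : ℝ) * v m)
  have e : ∑ m ∈ F, ∑ n ∈ G, conj ((C⁻¹ : ℝ) * v m) * A m n * x n =
      ((C⁻¹ * ∑ m ∈ F, ‖v m‖ ^ 2 : ℝ) : ℂ) := by
    rw [ofReal_mul, ofReal_sum, mul_sum]
    refine sum_congr rfl fun m _ => ?_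
    rw [ofReal_pow]
    simp only [mul_assoc]
    rw [← mul_sum, map_mul, conj_ofReal, ← conj_mul', mul_assoc]
  rw [e, norm_real, Real.norm_of_nonneg (by positivity)] at h
  simp only [norm_mul, mul_pow, norm_real, Real.norm_eq_abs, sq_abs] at h
  rw [← mul_sum] at h
  change ∑ m ∈ F, ‖v m‖ ^ 2 ≤ _
  generalize ∑ m ∈ F, ‖v m‖ ^ 2 = V at h ⊢
  have h2 := mul_le_mul_of_nonneg_left h (show 0 ≤ 2 * C by positivity)
  have e1 : 2 * C * (C⁻¹ * V) = 2 * V := by field_simp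
  have e2 : 2 * C * (C / 2 * (∑ n ∈ G, ‖x n‖ ^ 2 + C⁻¹ ^ 2 * V)) =
    C ^ 2 * (∑ n ∈ G, ‖x n‖ ^ 2) + V := by field_simp
  linarith

lemma sum_norm_sq_le_lp (x : lp (fun _ : ι => ℂ) 2) (G : Finset ι) :
    ∑ n ∈ G, ‖x n‖ ^ 2 ≤ ‖x‖ ^ 2 := by
  have := lp.sum_rpow_le_norm_rpow (p := 2) (by norm_num) x G
  simpa using this

lemma summable (hA : FiniteFormBound A C) (hC : 0 < C) (x : lp (fun _ : ι => ℂ) 2) (m : ι) :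
    Summable fun n => A m n * x n := by
  refine Summable.of_norm <| summable_of_sum_le (c := C * ‖x‖) (fun _ => norm_nonneg _) fun G => ?_
  let z : ι → ℂ := fun n => if A m n = 0 then 0 else conj (A m n) / ‖A m n‖ * ‖x n‖
  have hz : ∀ n, A m n * z n = (‖A m n * x n‖ : ℝ) := by
    intro n
    by_cases h : A m n = 0
    · simp [h, z]
    · have h' : (‖A m n‖ : ℂ) ≠ 0 := by simpa using h
      simp only [z, if_neg h, norm_mul, ofReal_mul]
      rw [← mul_assoc, mul_div_assoc', mul_conj']
      field_simp
  have hz' : ∀ n, ‖z n‖ ≤ ‖x n‖ := by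
    intro n
    by_cases h : A m n = 0
    · simp [h, z]
    · simp [z, h]
  have h := hA.sum_norm_sq_le hC {m} G z
  simp only [sum_singleton, hz] at h
  rw [← ofReal_sum, norm_real, Real.norm_of_nonneg (sum_nonneg fun _ _ => norm_nonneg _)] at h
  refine (sq_le_sq₀ (sum_nonneg fun _ _ => norm_nonneg _) (by positivity)).1 (h.trans ?_)
  rw [mul_pow]
  gcongr
  exact (sum_le_sum fun n _ => by gcongr; exact hz' n).trans (sum_norm_sq_le_lp x G)

lemma sum_norm_tsum_sq_le (hA : FiniteFormBound A C) (hC : 0 < C) (x : lp (fun _ : ι => ℂ) 2)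
    (F : Finset ι) : ∑ m ∈ F, ‖∑' n, A m n * x n‖ ^ 2 ≤ (C * ‖x‖) ^ 2 := by
  have lim : Tendsto (fun G : Finset ι => ∑ m ∈ F, ‖∑ n ∈ G, A m n * x n‖ ^ 2) atTop
      (𝓝 (∑ m ∈ F, ‖∑' n, A m n * x n‖ ^ 2)) :=
    tendsto_finsetSum _ fun m _ => ((hA.summable hC x m).hasSum.norm).pow 2
  refine le_of_tendsto' lim fun G => (hA.sum_norm_sq_le hC F G x).trans ?_
  rw [mul_pow]
  gcongr
  exact sum_norm_sq_le_lp x G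

/-- A matrix with a bounded form is the matrix of a bounded operator on `ℓ²`. -/
theorem exists_clm [DecidableEq ι] (hA : FiniteFormBound A C) (hC : 0 < C) :
    ∃ T : lp (fun _ : ι => ℂ) 2 →L[ℂ] lp (fun _ : ι => ℂ) 2, ‖T‖ ≤ C ∧
      ∀ m n, @inner ℂ _ _ (lp.single 2 m (1 : ℂ)) (T (lp.single 2 n (1 : ℂ))) = A m n := by
  have mem : ∀ x : lp (fun _ : ι => ℂ) 2, Memℓp (fun m => ∑' n, A m n * x n) 2 := fun x =>
    memℓp_gen' (C := (C * ‖x‖) ^ 2) fun F => by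
      simpa using hA.sum_norm_tsum_sq_le hC x F
  let L : lp (fun _ : ι => ℂ) 2 →ₗ[ℂ] lp (fun _ : ι => ℂ) 2 :=
    { toFun := fun x => ⟨_, mem x⟩
      map_add' := fun x y => by
        ext m
        simp only [lp.coeFn_add, Pi.add_apply, mul_add]
        exact (hA.summable hC x m).tsum_add (hA.summable hC y m)
      map_smul' := fun c x => by
        ext m
        simp only [lp.coeFn_smul, Pi.smul_apply, smul_eq_mul, RingHom.id_apply]
        rw [← tsum_mul_left]
        exact tsum_congr fun n => by ring }
  refine ⟨L.mkContinuous C fun x => ?_, L.mkContinuous_norm_le hC.le _, fun m n => ?_⟩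
  · refine lp.norm_le_of_forall_sum_le (by norm_num) (by positivity) fun F => ?_
    simpa [L] using hA.sum_norm_tsum_sq_le hC x F
  · rw [lp.inner_single_left]
    simp only [LinearMap.mkContinuous_apply, L, LinearMap.coe_mk, AddHom.coe_mk]
    rw [tsum_eq_single n fun k hk => by simp [lp.single_apply, hk]]
    simp

end FiniteFormBound

section Hilbert

open Complex ComplexConjugate Finset

lemma integral_exp_int_mul_I (k : ℤ) :
    ∫ θ in (0 : ℝ)..2 * Real.pi, exp (k * θ * I) = if k = 0 then 2 * (Real.pi : ℂ) else 0 := by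
  split_ifs with h
  · simp [h]
  · have hk : (k * I : ℂ) ≠ 0 := by simp [h]
    have := integral_exp_mul_complex (a := 0) (b := 2 * Real.pi) hk
    simp only [mul_right_comm _ I] at this
    rw [this]
    have : exp (k * ((2 * Real.pi : ℝ) : ℂ) * I) = 1 := by
      rw [exp_eq_one_iff]
      exact ⟨k, by push_cast; ring⟩
    rw [this]
    simp

lemma integral_pi_sub_mul_exp_int_mul_I (k : ℤ) :
    ∫ θ in (0 : ℝ)..2 * Real.pi, ((Real.pi - θ : ℝ) : ℂ) * exp (k * θ * I) =
      2 * Real.pi * if k = 0 then 0 else I / k := by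
  split_ifs with h
  · simp only [h, Int.cast_zero, zero_mul, exp_zero, mul_one, mul_zero]
    rw [intervalIntegral.integral_ofReal, intervalIntegral.integral_sub (by simp) (by simp)]
    simp
    ring
  · have hk : (k : ℂ) ≠ 0 := by simpa using h
    have hd : ∀ θ ∈ Set.uIcc (0 : ℝ) (2 * Real.pi),
        HasDerivAt (fun θ : ℝ => ((Real.pi - θ : ℝ) : ℂ)) (-1) θ := by
      intro θ _
      have := ((hasDerivAt_id θ).const_sub Real.pi).ofReal_comp
      simpa using this
    have he : ∀ θ ∈ Set.uIcc (0 : ℝ) (2 * Real.pi),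
        HasDerivAt (fun θ : ℝ => exp (k * θ * I) / (k * I)) (exp (k * θ * I)) θ := by
      intro θ _
      have := ((((hasDerivAt_id θ).ofReal_comp.const_mul (k : ℂ)).mul_const I).cexp).div_const
        (k * I : ℂ)
      refine this.congr_deriv ?_
      simp only [id, ofReal_one, mul_one]
      field_simp
    have := intervalIntegral.integral_mul_deriv_eq_deriv_mul hd he (by simp)
      (Continuous.intervalIntegrable (by fun_prop) _ _)
    rw [this]
    have e : exp (k * ((2 * Real.pi : ℝ) : ℂ) * I) = 1 := by
      rw [exp_eq_one_iff]
      exact ⟨k, by push_cast; ring⟩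
    rw [e]
    simp only [neg_one_mul, intervalIntegral.integral_neg, intervalIntegral.integral_div,
      integral_exp_int_mul_I, if_neg h]
    simp
    field_simp
    norm_num

/-- Matrix coefficients of a multiplication operator against trigonometric polynomials. -/
lemma integral_mul_conj_trig_mul_trig (g : ℝ → ℂ) (hg : Continuous g) (F G : Finset ℕ+)
    (x y : ℕ+ → ℂ) :
    ∫ θ in (0 : ℝ)..2 * Real.pi, g θ * (conj (∑ m ∈ F, y m * exp ((m : ℕ) * θ * I)) *
        ∑ n ∈ G, x n * exp ((n : ℕ) * θ * I)) =
      ∑ m ∈ F, ∑ n ∈ G, conj (y m) *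
        (∫ θ in (0 : ℝ)..2 * Real.pi,
          g θ * exp (((((n : ℕ) : ℤ) - ((m : ℕ) : ℤ) : ℤ) : ℂ) * θ * I)) * x n := by
  have e : ∀ θ : ℝ, g θ * (conj (∑ m ∈ F, y m * exp ((m : ℕ) * θ * I)) *
        ∑ n ∈ G, x n * exp ((n : ℕ) * θ * I)) =
      ∑ m ∈ F, ∑ n ∈ G, (conj (y m) * x n) *
        (g θ * exp (((((n : ℕ) : ℤ) - ((m : ℕ) : ℤ) : ℤ) : ℂ) * θ * I)) := by
    intro θ
    rw [map_sum, sum_mul_sum, mul_sum]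
    refine sum_congr rfl fun m _ => ?_
    rw [mul_sum]
    refine sum_congr rfl fun n _ => ?_
    have : exp (((((n : ℕ) : ℤ) - ((m : ℕ) : ℤ) : ℤ) : ℂ) * θ * I) =
        conj (exp ((m : ℕ) * θ * I)) * exp ((n : ℕ) * θ * I) := by
      rw [← exp_conj, ← exp_add]
      congr 1
      simp
      ring
    rw [this, map_mul]
    ring
  simp_rw [e]
  rw [intervalIntegral.integral_finsetSum
    fun m _ => Continuous.intervalIntegrable (by fun_prop) _ _]
  refine sum_congr rfl fun m _ => ?_
  rw [intervalIntegral.integral_finsetSum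
    fun n _ => Continuous.intervalIntegrable (by fun_prop) _ _]
  refine sum_congr rfl fun n _ => ?_
  rw [intervalIntegral.integral_const_mul]
  ring

lemma integral_norm_trig_sq (F : Finset ℕ+) (x : ℕ+ → ℂ) :
    ∫ θ in (0 : ℝ)..2 * Real.pi, ‖∑ n ∈ F, x n * exp ((n : ℕ) * θ * I)‖ ^ 2 =
      2 * Real.pi * ∑ n ∈ F, ‖x n‖ ^ 2 := by
  have h := integral_mul_conj_trig_mul_trig (fun _ => 1) continuous_const F F x x
  simp only [one_mul, integral_exp_int_mul_I, conj_mul', ← ofReal_pow] at h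
  rw [intervalIntegral.integral_ofReal] at h
  apply ofReal_injective
  rw [h]
  push_cast
  rw [mul_sum]
  refine sum_congr rfl fun m hm => ?_
  rw [sum_eq_single_of_mem m hm]
  · rw [← conj_mul']
    simp
    ring
  · intro n _ hn
    have : ¬ (((n : ℕ) : ℤ) - ((m : ℕ) : ℤ) = 0) := by
      rw [sub_eq_zero]
      exact_mod_cast hn
    rw [if_neg this]
    simp

/-- **Hilbert's inequality** with the sharp constant `π`. -/
theorem finiteFormBound_hilbert :
    FiniteFormBound (fun m n : ℕ+ => if m = n then 0 else I / (((n : ℕ) : ℂ) - ((m : ℕ) : ℂ)))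
      Real.pi := by
  intro F G x y
  set X : ℝ → ℂ := fun θ => ∑ n ∈ G, x n * exp ((n : ℕ) * θ * I)
  set Y : ℝ → ℂ := fun θ => ∑ n ∈ F, y n * exp ((n : ℕ) * θ * I)
  have cX : Continuous X := by fun_prop
  have cY : Continuous Y := by fun_prop
  have h := integral_mul_conj_trig_mul_trig (fun θ => ((Real.pi - θ : ℝ) : ℂ)) (by fun_prop) F G x y
  have hform : ∫ θ in (0 : ℝ)..2 * Real.pi, ((Real.pi - θ : ℝ) : ℂ) * (conj (Y θ) * X θ) =
      2 * Real.pi * ∑ m ∈ F, ∑ n ∈ G, conj (y m) *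
        (if m = n then 0 else I / (((n : ℕ) : ℂ) - ((m : ℕ) : ℂ))) * x n := by
    rw [h, mul_sum]
    refine sum_congr rfl fun m _ => ?_
    rw [mul_sum]
    refine sum_congr rfl fun n _ => ?_
    rw [integral_pi_sub_mul_exp_int_mul_I]
    have : (((n : ℕ) : ℤ) - ((m : ℕ) : ℤ) = 0) ↔ m = n := by
      rw [sub_eq_zero, eq_comm]
      norm_cast
    simp only [this]
    push_cast
    ring
  have hbound : ‖∫ θ in (0 : ℝ)..2 * Real.pi, ((Real.pi - θ : ℝ) : ℂ) * (conj (Y θ) * X θ)‖ ≤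
      ∫ θ in (0 : ℝ)..2 * Real.pi, Real.pi / 2 * (‖X θ‖ ^ 2 + ‖Y θ‖ ^ 2) := by
    refine intervalIntegral.norm_integral_le_of_norm_le Real.two_pi_pos.le
      (Filter.Eventually.of_forall fun θ hθ => ?_)
      (Continuous.intervalIntegrable (by fun_prop) _ _)
    have h1 : |Real.pi - θ| ≤ Real.pi := abs_le.2 ⟨by linarith [hθ.2], by linarith [hθ.1]⟩
    rw [norm_mul, norm_mul, RCLike.norm_conj, norm_real, Real.norm_eq_abs]
    calc |Real.pi - θ| * (‖Y θ‖ * ‖X θ‖) ≤ Real.pi * (‖Y θ‖ * ‖X θ‖) := by gcongr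
      _ ≤ Real.pi * ((‖X θ‖ ^ 2 + ‖Y θ‖ ^ 2) / 2) := by
        gcongr
        linarith [two_mul_le_add_sq ‖X θ‖ ‖Y θ‖]
      _ = _ := by ring
  rw [hform, intervalIntegral.integral_const_mul, intervalIntegral.integral_add
    (Continuous.intervalIntegrable (by fun_prop) _ _)
    (Continuous.intervalIntegrable (by fun_prop) _ _), integral_norm_trig_sq,
    integral_norm_trig_sq, norm_mul, ← mul_add, mul_left_comm] at hbound
  have hn : ‖(2 * Real.pi : ℂ)‖ = 2 * Real.pi := by
    simp [abs_of_pos Real.pi_pos]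
  rw [hn] at hbound
  exact le_of_mul_le_mul_left hbound Real.two_pi_pos

end Hilbert

/-- The kernel `min ((m/n)^σ) ((n/m)^σ)` is locally a Gram matrix of unit vectors. -/
lemma exists_gram_min_rpow (σ : ℝ) (hσ : 0 ≤ σ) (F : Finset ℕ+) :
    ∃ (K : Finset ℕ) (φ : ℕ → ℕ+ → ℝ),
      (∀ m ∈ F, ∀ n ∈ F, min ((((m : ℕ) : ℝ) / ((n : ℕ) : ℝ)) ^ σ)
        ((((n : ℕ) : ℝ) / ((m : ℕ) : ℝ)) ^ σ) = ∑ k ∈ K, φ k m * φ k n) ∧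
      ∀ m ∈ F, ∑ k ∈ K, φ k m ^ 2 = 1 := by
  let f : ℕ → ℝ := fun j => if j = 0 then 0 else (j : ℝ) ^ (2 * σ)
  have hf : ∀ k, 0 ≤ f (k + 1) - f k := by
    intro k
    rw [sub_nonneg]
    by_cases hk : k = 0
    · simp [f, hk]
    · simp only [f, hk, Nat.succ_ne_zero, if_false]
      gcongr
      simp
  let φ : ℕ → ℕ+ → ℝ := fun k m =>
    if k < m then √(f (k + 1) - f k) * ((m : ℕ) : ℝ) ^ (-σ) else 0
  have hpos : ∀ m : ℕ+, (0 : ℝ) < ((m : ℕ) : ℝ) := fun m => by exact_mod_cast m.pos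
  have gram : ∀ m ∈ F, ∀ n ∈ F, m ≤ n →
      ∑ k ∈ Finset.range (F.sup (fun m : ℕ+ => (m : ℕ))), φ k m * φ k n =
        (((m : ℕ) : ℝ) / ((n : ℕ) : ℝ)) ^ σ := by
    intro m hm n hn hmn
    have hle : (m : ℕ) ≤ F.sup (fun m : ℕ+ => (m : ℕ)) :=
      Finset.le_sup (f := fun m : ℕ+ => (m : ℕ)) hm
    have hmn' : (m : ℕ) ≤ n := by exact_mod_cast hmn
    rw [← Finset.sum_subset (Finset.range_subset_range.2 hle)]
    · calc ∑ k ∈ Finset.range m, φ k m * φ k n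
          = ∑ k ∈ Finset.range m,
              (f (k + 1) - f k) * (((m : ℕ) : ℝ) ^ (-σ) * ((n : ℕ) : ℝ) ^ (-σ)) := by
            refine Finset.sum_congr rfl fun k hk => ?_
            have hk := Finset.mem_range.1 hk
            simp only [φ, if_pos hk, if_pos (hk.trans_le hmn')]
            rw [mul_mul_mul_comm, Real.mul_self_sqrt (hf k)]
        _ = ((m : ℕ) : ℝ) ^ (2 * σ) * (((m : ℕ) : ℝ) ^ (-σ) * ((n : ℕ) : ℝ) ^ (-σ)) := by
            rw [← Finset.sum_mul, Finset.sum_range_sub]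
            simp [f]
        _ = _ := by
            rw [← mul_assoc, ← Real.rpow_add (hpos m), Real.div_rpow (hpos m).le (hpos n).le,
              Real.rpow_neg (hpos n).le, div_eq_mul_inv]
            congr 2
            ring
    · intro k _ hk
      have : ¬ k < (m : ℕ) := by simpa using hk
      simp [φ, this]
  have ratio : ∀ m n : ℕ+, m ≤ n →
      (((m : ℕ) : ℝ) / ((n : ℕ) : ℝ)) ^ σ ≤ (((n : ℕ) : ℝ) / ((m : ℕ) : ℝ)) ^ σ := by
    intro m n hmn
    have h : ((m : ℕ) : ℝ) ≤ ((n : ℕ) : ℝ) := by exact_mod_cast hmn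
    have := hpos m
    have := hpos n
    refine Real.rpow_le_rpow (by positivity) ?_ hσ
    exact ((div_le_one (hpos n)).2 h).trans ((one_le_div (hpos m)).2 h)
  refine ⟨Finset.range (F.sup fun m : ℕ+ => (m : ℕ)), φ, fun m hm n hn => ?_, fun m hm => ?_⟩
  · rcases le_total m n with h | h
    · rw [min_eq_left (ratio m n h), gram m hm n hn h]
    · rw [min_eq_right (ratio n m h), ← gram n hn m hm h]
      exact Finset.sum_congr rfl fun k _ => mul_comm _ _
  · simp only [sq]
    rw [gram m hm m hm le_rfl, div_self (hpos m).ne', Real.one_rpow]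


/-- For every real `σ ≥ 0`, the infinite matrix indexed by positive integers
with entries `0` on the diagonal and `(i/(n−m))·min{(m/n)^σ, (n/m)^σ}` for `m ≠ n`
defines a bounded linear operator on `ℓ²(ℕ)` of norm at most `π + (√2/3 + 4)·π²·σ`. -/
theorem stmt_7 (σ : ℝ) (hσ : 0 ≤ σ) :
    ∃ T : lp (fun _ : ℕ+ => ℂ) 2 →L[ℂ] lp (fun _ : ℕ+ => ℂ) 2,
      ‖T‖ ≤ Real.pi + (Real.sqrt 2 / 3 + 4) * Real.pi ^ 2 * σ ∧
      ∀ m n : ℕ+,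
        @inner ℂ _ _ (lp.single 2 m (1 : ℂ)) (T (lp.single 2 n (1 : ℂ))) =
          if m = n then 0
          else
            (Complex.I / (((n : ℕ) : ℂ) - ((m : ℕ) : ℂ))) *
              ((min ((((m : ℕ) : ℝ) / ((n : ℕ) : ℝ)) ^ σ)
                  ((((n : ℕ) : ℝ) / ((m : ℕ) : ℝ)) ^ σ) : ℝ) : ℂ) := by
  obtain ⟨T, hT, h⟩ := (finiteFormBound_hilbert.schur_mul _
    (exists_gram_min_rpow σ hσ)).exists_clm Real.pi_pos
  refine ⟨T, hT.trans (le_add_of_nonneg_right (by positivity)), fun m n => ?_⟩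
  rw [h, ite_mul, zero_mul]
end

section
/- The infinite matrix indexed by m,n ∈ ℕ = {1,2,3,…} with entries equal to 0 for m = n and i/(n−m) for m ≠ n defines a bounded linear operator on ℓ²(ℕ) whose operator norm is at most π. -/
open MeasureTheory in
/-- Multiplication by a bounded measurable function on `L²` of the circle, together with its
matrix in the Fourier basis. -/
theorem exists_mul_clm_inner_fourierLp {T : ℝ} [Fact (0 < T)] {φ : AddCircle T → ℂ} {C : ℝ}
    (hC : 0 ≤ C) (hφ : AEStronglyMeasurable φ AddCircle.haarAddCircle)
    (hφC : ∀ x, ‖φ x‖ ≤ C) :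
    ∃ M : Lp ℂ 2 (@AddCircle.haarAddCircle T _) →L[ℂ] Lp ℂ 2 (@AddCircle.haarAddCircle T _),
      ‖M‖ ≤ C ∧ ∀ m n : ℤ,
        inner ℂ (fourierLp 2 m) (M (fourierLp 2 n)) = fourierCoeff φ (m - n) := by
  have hφ_top : MemLp φ ⊤ AddCircle.haarAddCircle :=
    memLp_top_of_bound hφ C (.of_forall hφC)
  set B := ContinuousLinearMap.mul ℂ ℂ
  refine ⟨B.holderL AddCircle.haarAddCircle ⊤ 2 2 hφ_top.toLp, ?_, fun m n => ?_⟩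
  · calc _ ≤ ‖B.holderL (@AddCircle.haarAddCircle T _) ⊤ 2 2‖ * ‖hφ_top.toLp‖ :=
          ContinuousLinearMap.le_opNorm _ _
      _ ≤ 1 * C := by
          gcongr
          · exact B.norm_holderL_le.trans (ContinuousLinearMap.opNorm_mul_le ℂ ℂ)
          · refine (Lp.norm_le_of_ae_bound (C := C) hC ?_).trans (by simp)
            filter_upwards [hφ_top.coeFn_toLp] with x hx
            rw [hx]
            exact hφC x
      _ = C := one_mul C
  · rw [L2.inner_def, fourierCoeff]
    refine integral_congr_ae ?_
    filter_upwards [coeFn_fourierLp 2 m, coeFn_fourierLp 2 n, hφ_top.coeFn_toLp,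
      B.coeFn_holder (r := 2) hφ_top.toLp (fourierLp 2 n)] with x hm hn hx hB
    change inner ℂ _ (B.holder 2 hφ_top.toLp (fourierLp 2 n) x) = _
    rw [hB, hm, hn, hx, RCLike.inner_apply, ← fourier_neg, neg_sub, sub_eq_add_neg, fourier_add]
    simp only [B, ContinuousLinearMap.mul_apply', smul_eq_mul]
    ring

theorem measurable_periodizedBernoulli (k : ℕ) : Measurable (periodizedBernoulli k) := by
  have : Measurable ((Set.Ico (0 : ℝ) (0 + 1)).domRestrict (bernoulliFun k)) :=
    (Polynomial.continuous _).measurable.comp measurable_subtype_coe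
  exact this.comp (AddCircle.measurableEquivIco 1 0).measurable

theorem abs_periodizedBernoulli_one_le (x : UnitAddCircle) :
    |periodizedBernoulli 1 x| ≤ 1 / 2 := by
  change |bernoulliFun 1 (AddCircle.equivIco 1 0 x : ℝ)| ≤ 1 / 2
  obtain ⟨h0, h1⟩ := (AddCircle.equivIco 1 0 x).2
  rw [bernoulliFun_one, abs_le]
  constructor <;> linarith

/-- The infinite matrix indexed by positive integers with entries `0` on
the diagonal and `i/(n−m)` for `m ≠ n` defines a bounded linear operator on `ℓ²(ℕ)`
of operator norm at most `π`. -/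
theorem stmt_8 :
    ∃ T : lp (fun _ : ℕ+ => ℂ) 2 →L[ℂ] lp (fun _ : ℕ+ => ℂ) 2,
      ‖T‖ ≤ Real.pi ∧
      ∀ m n : ℕ+,
        @inner ℂ _ _ (lp.single 2 m (1 : ℂ)) (T (lp.single 2 n (1 : ℂ))) =
          if m = n then 0
          else Complex.I / (((n : ℕ) : ℂ) - ((m : ℕ) : ℂ)) := by
  obtain ⟨M, hM, hMF⟩ := exists_mul_clm_inner_fourierLp (T := 1)
    (φ := fun x => (-2 * Real.pi : ℂ) * (periodizedBernoulli 1 x : ℂ)) Real.pi_pos.le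
    (measurable_const.mul (Complex.measurable_ofReal.comp
      (measurable_periodizedBernoulli 1))).aestronglyMeasurable
    fun x => by
      rw [norm_mul, Complex.norm_real, Real.norm_eq_abs]
      have := abs_periodizedBernoulli_one_le x
      have hpi := Real.pi_pos
      simp only [norm_mul, norm_neg, Complex.norm_ofNat, Complex.norm_real, Real.norm_eq_abs,
        abs_of_pos hpi]
      nlinarith
  have hcast : Function.Injective fun n : ℕ+ => ((n : ℕ) : ℤ) :=
    Nat.cast_injective.comp PNat.coe_injective
  have hF := ((orthonormal_fourier (T := 1)).comp _ hcast).orthogonalFamily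
  set J := hF.linearIsometry.toContinuousLinearMap
  have hJ : ‖J‖ ≤ 1 := hF.linearIsometry.norm_toContinuousLinearMap_le
  have hJ_single (n : ℕ+) : J (lp.single 2 n (1 : ℂ)) = fourierLp 2 ((n : ℕ) : ℤ) := by
    simp [J]
  refine ⟨J.adjoint ∘L M ∘L J, ?_, fun m n => ?_⟩
  · calc _ ≤ ‖J.adjoint‖ * (‖M‖ * ‖J‖) :=
          (ContinuousLinearMap.opNorm_comp_le _ _).trans
            (by gcongr; exact ContinuousLinearMap.opNorm_comp_le _ _)
      _ ≤ 1 * (Real.pi * 1) := by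
          gcongr
          rwa [LinearIsometryEquiv.norm_map]
      _ = Real.pi := by ring
  · simp only [ContinuousLinearMap.comp_apply]
    rw [ContinuousLinearMap.adjoint_inner_right, hJ_single, hJ_single, hMF,
      fourierCoeff.const_mul]
    have hB := fourierCoeff_bernoulli_eq one_ne_zero (((m : ℕ) : ℤ) - ((n : ℕ) : ℤ))
    simp only [Function.comp_def] at hB
    rw [hB]
    split_ifs with h
    · simp [h]
    · have hne : ((n : ℕ) : ℂ) - ((m : ℕ) : ℂ) ≠ 0 := by
        rw [sub_ne_zero, Ne, Nat.cast_inj, PNat.coe_inj]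
        exact Ne.symm h
      have hne' : ((m : ℕ) : ℂ) - ((n : ℕ) : ℂ) ≠ 0 := by
        rwa [← neg_sub, neg_ne_zero]
      have hpi : (Real.pi : ℂ) ≠ 0 := Complex.ofReal_ne_zero.2 Real.pi_ne_zero
      push_cast
      simp only [Nat.factorial_one, Nat.cast_one, pow_one]
      field_simp
      rw [Complex.I_sq]
      ring
end

section
/- Let s > 0 and for x ≥ 1 set g_s(x) = Γ(x+s)/(x^s·Γ(x)). Then g_s is differentiable on [1,∞), g_s(x) > 0, and for every x ≥ 1 the logarithmic derivative satisfies −s²/(2x²) ≤ g_s′(x)/g_s(x) ≤ s/x²; in particular |g_s′(x)| ≤ s(s+1)·g_s(x)/x². -/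
open Filter Topology in
/-- A real function that does not increase along `x, x + 1, x + 2, …` and tends to `0` along
this sequence is nonnegative at `x`. -/
theorem nonneg_of_add_one_le_of_tendsto_zero {f : ℝ → ℝ} {x : ℝ} (hx : 0 < x)
    (hf : ∀ y, 0 < y → f (y + 1) ≤ f y) (hlim : Tendsto f atTop (𝓝 0)) : 0 ≤ f x := by
  have hanti : Antitone fun n : ℕ => f (x + n) := antitone_nat_of_succ_le fun n => by
    simpa [add_assoc] using hf (x + n) (by positivity)
  have hseq : Tendsto (fun n : ℕ => f (x + n)) atTop (𝓝 0) :=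
    hlim.comp (tendsto_atTop_add_const_left _ _ tendsto_natCast_atTop_atTop)
  simpa using hanti.le_of_tendsto hseq 0

namespace Real

theorem differentiableAt_Gamma_of_pos {x : ℝ} (hx : 0 < x) : DifferentiableAt ℝ Gamma x :=
  differentiableAt_Gamma fun m => by
    have : (0 : ℝ) ≤ m := m.cast_nonneg
    linarith

theorem logDeriv_Gamma_add_one {x : ℝ} (hx : 0 < x) :
    logDeriv Gamma (x + 1) = logDeriv Gamma x + 1 / x := by
  have heq : (fun y => Gamma (y + 1)) =ᶠ[nhds x] fun y => y * Gamma y := by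
    filter_upwards [eventually_ne_nhds hx.ne'] with y hy using Gamma_add_one hy
  have hd : deriv Gamma (x + 1) = 1 * Gamma x + x * deriv Gamma x := by
    rw [← deriv_comp_add_const, heq.deriv_eq]
    exact ((hasDerivAt_id x).mul (differentiableAt_Gamma_of_pos hx).hasDerivAt).deriv
  have hG := (Gamma_pos_of_pos hx).ne'
  rw [logDeriv_apply, logDeriv_apply, hd, Gamma_add_one hx.ne']
  field_simp
  ring

theorem logDeriv_Gamma_add_nat_le {x : ℝ} (hx : 0 < x) (n : ℕ) :
    logDeriv Gamma (x + n) ≤ logDeriv Gamma x + n / x := by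
  induction n with
  | zero => simp
  | succ n ih =>
    have h : 1 / (x + n) ≤ 1 / x := one_div_le_one_div_of_le hx (by simp)
    have h' := logDeriv_Gamma_add_one (x := x + n) (by positivity)
    push_cast
    rw [← add_assoc, h', add_div]
    linarith

theorem monotoneOn_logDeriv_Gamma : MonotoneOn (logDeriv Gamma) (Set.Ioi 0) := by
  have hderiv : ∀ x ∈ Set.Ioi (0 : ℝ), HasDerivAt (log ∘ Gamma) (logDeriv Gamma x) x :=
    fun x hx => by
      simpa [Function.comp_def, logDeriv_apply] using
        (differentiableAt_Gamma_of_pos hx).hasDerivAt.log (Gamma_pos_of_pos hx).ne'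
  exact (convexOn_log_Gamma.monotoneOn_deriv fun x hx => (hderiv x hx).differentiableAt).congr
    fun x hx => (hderiv x hx).deriv

open Filter Topology in
theorem tendsto_logDeriv_Gamma_add_sub_atTop {s : ℝ} (hs : 0 ≤ s) :
    Tendsto (fun x => logDeriv Gamma (x + s) - logDeriv Gamma x) atTop (𝓝 0) := by
  refine tendsto_of_tendsto_of_tendsto_of_le_of_le' tendsto_const_nhds
    (tendsto_id.const_div_atTop (⌈s⌉₊ : ℝ)) ?_ ?_
  · filter_upwards [eventually_gt_atTop 0] with x hx
    exact sub_nonneg.2 (monotoneOn_logDeriv_Gamma hx (Set.mem_Ioi.2 (by positivity)) (by linarith))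
  · filter_upwards [eventually_gt_atTop 0] with x hx
    have h := monotoneOn_logDeriv_Gamma (a := x + s) (b := x + ⌈s⌉₊)
      (Set.mem_Ioi.2 (by positivity)) (Set.mem_Ioi.2 (by positivity))
      (by linarith [Nat.le_ceil s])
    have h' := logDeriv_Gamma_add_nat_le hx ⌈s⌉₊
    simp only [id]
    linarith

open Filter Topology in
theorem tendsto_logDeriv_Gamma_add_sub_sub_div_atTop {s : ℝ} (hs : 0 ≤ s) :
    Tendsto (fun x => logDeriv Gamma (x + s) - logDeriv Gamma x - s / x) atTop (𝓝 0) := by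
  simpa using (tendsto_logDeriv_Gamma_add_sub_atTop hs).sub (tendsto_id.const_div_atTop s)

theorem logDeriv_Gamma_add_sub_sub_div_le {s x : ℝ} (hs : 0 < s) (hx : 0 < x) :
    logDeriv Gamma (x + s) - logDeriv Gamma x - s / x ≤ s / x ^ 2 := by
  rw [← sub_nonneg]
  refine nonneg_of_add_one_le_of_tendsto_zero
    (f := fun y => s / y ^ 2 - (logDeriv Gamma (y + s) - logDeriv Gamma y - s / y))
    hx (fun y hy => ?_) ?_
  · have h₁ := logDeriv_Gamma_add_one hy
    have h₂ := logDeriv_Gamma_add_one (add_pos hy hs)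
    have key : 0 ≤ s / y ^ 2 - s / (y + 1) ^ 2 - (1 / y - 1 / (y + s) - s / y + s / (y + 1)) := by
      have : s / y ^ 2 - s / (y + 1) ^ 2 - (1 / y - 1 / (y + s) - s / y + s / (y + 1)) =
          s * (y ^ 2 + s * (y ^ 2 + 2 * y + 1 + y)) / (y ^ 2 * (y + 1) ^ 2 * (y + s)) := by
        field_simp
        ring
      rw [this]
      positivity
    rw [add_right_comm y 1 s]
    linarith
  · simpa using (tendsto_const_nhds.div_atTop (Filter.tendsto_pow_atTop two_ne_zero)).sub
      (tendsto_logDeriv_Gamma_add_sub_sub_div_atTop hs.le)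

theorem le_logDeriv_Gamma_add_sub_sub_div {s x : ℝ} (hs : 0 < s) (hx : 0 < x) :
    -(s ^ 2) / (2 * x ^ 2) ≤ logDeriv Gamma (x + s) - logDeriv Gamma x - s / x := by
  rw [← sub_nonneg]
  refine nonneg_of_add_one_le_of_tendsto_zero
    (f := fun y => logDeriv Gamma (y + s) - logDeriv Gamma y - s / y - -(s ^ 2) / (2 * y ^ 2))
    hx (fun y hy => ?_) ?_
  · have h₁ := logDeriv_Gamma_add_one hy
    have h₂ := logDeriv_Gamma_add_one (add_pos hy hs)
    have key : 0 ≤ (1 / y - 1 / (y + s) - s / y + s / (y + 1)) -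
        (-(s ^ 2) / (2 * y ^ 2) - -(s ^ 2) / (2 * (y + 1) ^ 2)) := by
      have : (1 / y - 1 / (y + s) - s / y + s / (y + 1)) -
          (-(s ^ 2) / (2 * y ^ 2) - -(s ^ 2) / (2 * (y + 1) ^ 2)) =
          s * (2 * y ^ 2 + s ^ 2 + y * (2 * (s - 1 / 4) ^ 2 + 15 / 8)) /
            (2 * y ^ 2 * (y + 1) ^ 2 * (y + s)) := by
        field_simp
        ring
      rw [this]
      positivity
    rw [add_right_comm y 1 s]
    linarith
  · have hpow : Filter.Tendsto (fun y : ℝ => 2 * y ^ 2) Filter.atTop Filter.atTop :=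
      (Filter.tendsto_pow_atTop two_ne_zero).const_mul_atTop two_pos
    simpa using (tendsto_logDeriv_Gamma_add_sub_sub_div_atTop hs.le).sub
      (tendsto_const_nhds.div_atTop hpow)

theorem hasDerivAt_Gamma_add_div_rpow_mul_Gamma {s x : ℝ} (hs : 0 < s) (hx : 0 < x) :
    HasDerivAt (fun x : ℝ => Gamma (x + s) / (x ^ s * Gamma x))
      ((logDeriv Gamma (x + s) - logDeriv Gamma x - s / x) *
        (Gamma (x + s) / (x ^ s * Gamma x))) x := by
  have hxs : 0 < x + s := add_pos hx hs
  have hG := (Gamma_pos_of_pos hx).ne'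
  have hGs := (Gamma_pos_of_pos hxs).ne'
  have hp := (rpow_pos_of_pos hx s).ne'
  have h := ((differentiableAt_Gamma_of_pos hxs).hasDerivAt.comp_add_const x s).div
    ((hasDerivAt_rpow_const (p := s) (Or.inl hx.ne')).mul
      (differentiableAt_Gamma_of_pos hx).hasDerivAt) (mul_ne_zero hp hG)
  refine h.congr_deriv ?_
  simp only [Pi.mul_apply]
  rw [logDeriv_apply, logDeriv_apply, rpow_sub_one hx.ne']
  field_simp
  ring

end Real


/-- For `s > 0` and `g_s(x) = Γ(x+s)/(x^s·Γ(x))`, the function `g_s` is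
differentiable at every `x ≥ 1`, positive there, its logarithmic derivative satisfies
`−s²/(2x²) ≤ g_s′(x)/g_s(x) ≤ s/x²`, and in particular
`|g_s′(x)| ≤ s(s+1)·g_s(x)/x²`. -/
theorem stmt_11 (s : ℝ) (hs : 0 < s) (x : ℝ) (hx : 1 ≤ x) :
    DifferentiableAt ℝ (fun x : ℝ => Real.Gamma (x + s) / (x ^ s * Real.Gamma x)) x ∧
    0 < Real.Gamma (x + s) / (x ^ s * Real.Gamma x) ∧
    -(s ^ 2) / (2 * x ^ 2) ≤
      deriv (fun x : ℝ => Real.Gamma (x + s) / (x ^ s * Real.Gamma x)) x /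
        (Real.Gamma (x + s) / (x ^ s * Real.Gamma x)) ∧
    deriv (fun x : ℝ => Real.Gamma (x + s) / (x ^ s * Real.Gamma x)) x /
        (Real.Gamma (x + s) / (x ^ s * Real.Gamma x)) ≤ s / x ^ 2 ∧
    |deriv (fun x : ℝ => Real.Gamma (x + s) / (x ^ s * Real.Gamma x)) x| ≤
      s * (s + 1) * (Real.Gamma (x + s) / (x ^ s * Real.Gamma x)) / x ^ 2 := by
  have hx0 : 0 < x := by linarith
  have hd := Real.hasDerivAt_Gamma_add_div_rpow_mul_Gamma hs hx0
  have hpos : 0 < Real.Gamma (x + s) / (x ^ s * Real.Gamma x) :=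
    div_pos (Real.Gamma_pos_of_pos (by linarith))
      (mul_pos (Real.rpow_pos_of_pos hx0 s) (Real.Gamma_pos_of_pos hx0))
  have hlower := Real.le_logDeriv_Gamma_add_sub_sub_div hs hx0
  have hupper := Real.logDeriv_Gamma_add_sub_sub_div_le hs hx0
  refine ⟨hd.differentiableAt, hpos, ?_, ?_, ?_⟩
  · rwa [hd.deriv, mul_div_cancel_right₀ _ hpos.ne']
  · rwa [hd.deriv, mul_div_cancel_right₀ _ hpos.ne']
  · rw [hd.deriv, abs_mul, abs_of_pos hpos, mul_div_right_comm]
    refine mul_le_mul_of_nonneg_right (abs_le.2 ⟨le_trans ?_ hlower, hupper.trans ?_⟩) hpos.le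
    · rw [← neg_div, div_le_div_iff₀ (by positivity) (by positivity)]
      nlinarith [mul_pos (pow_pos hx0 2) (pow_pos hs 2), mul_pos (pow_pos hx0 2) hs]
    · gcongr
      nlinarith
end

section
/- Let s > 0, let m, n be integers with 0 ≤ m < n, and let t ∈ [0,1]. With g_s(x) = Γ(x+s)/(x^s·Γ(x)) one has g_s(m+1+(n−m)t) ≤ (1+s)^{1+s} · g_s(n+1). -/
namespace Real

/-- Log-convexity upper bound for a shift of the Gamma function. -/
theorem Gamma_add_le_Gamma_mul_add_rpow {y u : ℝ} (hy : 0 < y) (hu : 0 ≤ u) :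
    Gamma (y + u) ≤ Gamma y * (y + u) ^ u := by
  rcases hu.eq_or_lt with rfl | hu
  · simp
  have hyu : 0 < y + u := by linarith
  have hslope := convexOn_log_Gamma.slope_mono_adjacent (x := y) (y := y + u) (z := y + u + 1)
    (Set.mem_Ioi.2 hy) (Set.mem_Ioi.2 (by linarith)) (by linarith) (by linarith)
  simp only [Function.comp_apply, add_sub_cancel_left, div_one] at hslope
  rw [Gamma_add_one hyu.ne', log_mul hyu.ne' (Gamma_pos_of_pos hyu).ne', div_le_iff₀ hu] at hslope
  have hpow : 0 < (y + u) ^ u := rpow_pos_of_pos hyu u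
  rw [← log_le_log_iff (Gamma_pos_of_pos hyu) (mul_pos (Gamma_pos_of_pos hy) hpow),
    log_mul (Gamma_pos_of_pos hy).ne' hpow.ne', log_rpow hyu]
  linarith

/-- A sharper log-convexity upper bound for a shift of the Gamma function by at most one. -/
theorem Gamma_add_le_Gamma_mul_rpow_of_le_one {y u : ℝ} (hy : 0 < y) (hu : 0 ≤ u) (hu1 : u ≤ 1) :
    Gamma (y + u) ≤ Gamma y * y ^ u := by
  rcases hu.eq_or_lt with rfl | hu
  · simp
  rcases hu1.eq_or_lt with rfl | hu1
  · rw [rpow_one, Gamma_add_one hy.ne', mul_comm]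
  have hyu : 0 < y + u := by linarith
  have hslope := convexOn_log_Gamma.slope_mono_adjacent (x := y) (y := y + u) (z := y + 1)
    (Set.mem_Ioi.2 hy) (Set.mem_Ioi.2 (by linarith)) (by linarith) (by linarith)
  simp only [Function.comp_apply, add_sub_cancel_left, add_sub_add_left_eq_sub] at hslope
  rw [Gamma_add_one hy.ne', log_mul hy.ne' (Gamma_pos_of_pos hy).ne',
    div_le_div_iff₀ hu (sub_pos.2 hu1)] at hslope
  have hpow : 0 < y ^ u := rpow_pos_of_pos hy u
  rw [← log_le_log_iff (Gamma_pos_of_pos hyu) (mul_pos (Gamma_pos_of_pos hy) hpow),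
    log_mul (Gamma_pos_of_pos hy).ne' hpow.ne', log_rpow hy]
  linarith

/-- Log-convexity lower bound for a shift of the Gamma function. -/
theorem Gamma_add_one_mul_rpow_le_Gamma_add {y u : ℝ} (hy : 0 < y) (hu : 0 ≤ u) :
    Gamma (y + 1) * y ^ u ≤ Gamma (y + 1 + u) := by
  rcases hu.eq_or_lt with rfl | hu
  · simp
  have hy1 : 0 < y + 1 := by linarith
  have hyu : 0 < y + 1 + u := by linarith
  have hslope := convexOn_log_Gamma.slope_mono_adjacent (x := y) (y := y + 1) (z := y + 1 + u)
    (Set.mem_Ioi.2 hy) (Set.mem_Ioi.2 hyu) (by linarith) (by linarith)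
  simp only [Function.comp_apply, add_sub_cancel_left, div_one] at hslope
  have hstep : log (Gamma (y + 1)) = log y + log (Gamma y) := by
    rw [Gamma_add_one hy.ne', log_mul hy.ne' (Gamma_pos_of_pos hy).ne']
  rw [le_div_iff₀ hu] at hslope
  have hpow : 0 < y ^ u := rpow_pos_of_pos hy u
  rw [← log_le_log_iff (mul_pos (Gamma_pos_of_pos hy1) hpow) (Gamma_pos_of_pos hyu),
    log_mul (Gamma_pos_of_pos hy1).ne' hpow.ne', log_rpow hy]
  rw [hstep] at hslope ⊢
  linarith

theorem Gamma_add_div_rpow_mul_Gamma_le {x s : ℝ} (hx : 1 ≤ x) (hs : 0 ≤ s) :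
    Gamma (x + s) / (x ^ s * Gamma x) ≤ (1 + s) ^ s := by
  have hx0 : 0 < x := by linarith
  have hG := Gamma_pos_of_pos hx0
  rw [div_le_iff₀ (mul_pos (rpow_pos_of_pos hx0 s) hG)]
  calc Gamma (x + s) ≤ Gamma x * (x + s) ^ s := Gamma_add_le_Gamma_mul_add_rpow hx0 hs
    _ ≤ Gamma x * ((1 + s) * x) ^ s := by
        gcongr
        nlinarith
    _ = (1 + s) ^ s * (x ^ s * Gamma x) := by
        rw [mul_rpow (by linarith) hx0.le]
        ring

theorem inv_one_add_le_Gamma_add_div_rpow_mul_Gamma {x s : ℝ} (hx : 1 ≤ x) (hs : 0 ≤ s) :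
    (1 + s)⁻¹ ≤ Gamma (x + s) / (x ^ s * Gamma x) := by
  have hx0 : 0 < x := by linarith
  have hs1 : 0 < 1 + s := by linarith
  have hG := Gamma_pos_of_pos hx0
  have hGs : 0 < Gamma (x + s) := Gamma_pos_of_pos (by linarith)
  have hpow := rpow_pos_of_pos hx0 s
  rw [le_div_iff₀ (mul_pos hpow hG), inv_mul_le_iff₀ hs1]
  rcases le_total 1 s with h | h
  · have hlower := Gamma_add_one_mul_rpow_le_Gamma_add hx0 (sub_nonneg.2 h)
    rw [add_add_sub_cancel, Gamma_add_one hx0.ne', rpow_sub_one hx0.ne'] at hlower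
    have hcancel : x * Gamma x * (x ^ s / x) = x ^ s * Gamma x := by field_simp
    rw [hcancel] at hlower
    nlinarith
  · have hupper := Gamma_add_le_Gamma_mul_rpow_of_le_one (y := x + s) (by linarith)
      (sub_nonneg.2 h) (by linarith)
    rw [add_add_sub_cancel, Gamma_add_one hx0.ne'] at hupper
    refine le_of_mul_le_mul_right ?_ (rpow_pos_of_pos hx0 (1 - s))
    have hone : x ^ s * x ^ (1 - s) = x := by
      rw [← rpow_add hx0, add_sub_cancel, rpow_one]
    calc x ^ s * Gamma x * x ^ (1 - s) = x * Gamma x := by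
          rw [mul_right_comm, hone]
      _ ≤ Gamma (x + s) * (x + s) ^ (1 - s) := hupper
      _ ≤ Gamma (x + s) * ((1 + s) * x) ^ (1 - s) := by
          gcongr
          nlinarith
      _ = Gamma (x + s) * ((1 + s) ^ (1 - s) * x ^ (1 - s)) := by
          rw [mul_rpow hs1.le hx0.le]
      _ ≤ Gamma (x + s) * ((1 + s) * x ^ (1 - s)) := by
          gcongr
          exact rpow_le_self_of_one_le (by linarith) (by linarith)
      _ = (1 + s) * Gamma (x + s) * x ^ (1 - s) := by ring

end Real


/-- For `s > 0`, integers `0 ≤ m < n` and `t ∈ [0,1]`, with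
`g_s(x) = Γ(x+s)/(x^s·Γ(x))` one has `g_s(m+1+(n−m)t) ≤ (1+s)^{1+s}·g_s(n+1)`. -/
theorem stmt_12 (s : ℝ) (hs : 0 < s) (m n : ℕ) (hmn : m < n)
    (t : ℝ) (ht : t ∈ Set.Icc (0 : ℝ) 1) :
    Real.Gamma (((m : ℝ) + 1 + ((n : ℝ) - (m : ℝ)) * t) + s) /
        (((m : ℝ) + 1 + ((n : ℝ) - (m : ℝ)) * t) ^ s *
          Real.Gamma ((m : ℝ) + 1 + ((n : ℝ) - (m : ℝ)) * t)) ≤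
      (1 + s) ^ (1 + s) *
        (Real.Gamma (((n : ℝ) + 1) + s) /
          (((n : ℝ) + 1) ^ s * Real.Gamma ((n : ℝ) + 1))) := by
  have hs1 : 0 < 1 + s := by linarith
  have hmn' : (m : ℝ) ≤ n := by exact_mod_cast hmn.le
  have hx : 1 ≤ (m : ℝ) + 1 + ((n : ℝ) - (m : ℝ)) * t := by
    have := mul_nonneg (sub_nonneg.2 hmn') ht.1
    have := m.cast_nonneg (α := ℝ)
    linarith
  have hN : 1 ≤ (n : ℝ) + 1 := by
    have := n.cast_nonneg (α := ℝ)
    linarith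
  calc _ ≤ (1 + s) ^ s := Real.Gamma_add_div_rpow_mul_Gamma_le hx hs.le
    _ = (1 + s) ^ (1 + s) * (1 + s)⁻¹ := by
        rw [Real.rpow_one_add' hs1.le hs1.ne']
        field_simp
    _ ≤ _ := by
        gcongr
        exact Real.inv_one_add_le_Gamma_add_div_rpow_mul_Gamma hN hs.le
end
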